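/- arXiv:math/0609094 — 8 statements merged into one kernel-verified Lean document; each statement's English description precedes it below -/
import Mathlib

section
/- Error formula for Padé approximation to a Markov function: let μ be a finite positive Borel measure on ℝ with support an infinite subset of a compact interval [a,b], let f(z) = ∫ dμ(x)/(z − x), let Q_n be a monic polynomial of degree n with real coefficients satisfying ∫ x^k Q_n(x) dμ(x) = 0 for k = 0, 1, …, n−1, and set P_{n−1}(z) = ∫ (Q_n(z) − Q_n(x))/(z − x) dμ(x). Then for every z ∈ ℂ \ [a,b], Q_n(z) ≠ 0 and f(z) − P_{n−1}(z)/Q_n(z) = (1/Q_n(z)²) ∫ Q_n(x)² dμ(x)/(z − x). -/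
open MeasureTheory Polynomial

/-- The support of a Borel measure on `ℝ`: the set of points all of whose neighborhoods
have positive measure. -/
def measureSupport (μ : Measure ℝ) : Set ℝ :=
  {x | ∀ ε > 0, 0 < μ (Metric.ball x ε)}

lemma pade_null (μ : Measure ℝ) (a b : ℝ)
    (hsupp : measureSupport μ ⊆ Set.Icc a b) : μ (Set.Icc a b)ᶜ = 0 := by
  apply measure_null_of_locally_null
  intro x hx
  have hx' : x ∉ measureSupport μ := fun h => hx (hsupp h)
  simp only [measureSupport, Set.mem_setOf_eq, not_forall, not_lt] at hx'
  obtain ⟨ε, hε, h⟩ := hx'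
  exact ⟨Metric.ball x ε, mem_nhdsWithin_of_mem_nhds (Metric.ball_mem_nhds x hε),
    le_antisymm h (zero_le)⟩

lemma pade_integrable {E : Type*} [NormedAddCommGroup E] (μ : Measure ℝ) [IsFiniteMeasure μ]
    (a b : ℝ) (hnull : μ (Set.Icc a b)ᶜ = 0) (g : ℝ → E) (hg : ContinuousOn g (Set.Icc a b)) :
    Integrable g μ := by
  have h := hg.integrableOn_compact (μ := μ) isCompact_Icc
  have hr : μ.restrict (Set.Icc a b) = μ :=
    Measure.restrict_eq_self_of_ae_mem (by rw [ae_iff]; exact hnull)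
  rwa [IntegrableOn, hr] at h

lemma pade_orth (μ : Measure ℝ) [IsFiniteMeasure μ] (a b : ℝ) (hnull : μ (Set.Icc a b)ᶜ = 0)
    (n : ℕ) (Q : Polynomial ℝ)
    (horth : ∀ k : ℕ, k < n → ∫ x, x ^ k * Q.eval x ∂μ = 0)
    (p : Polynomial ℂ) (hp : p.degree < n) :
    ∫ x, p.eval (x : ℂ) * ((Q.eval x : ℝ) : ℂ) ∂μ = 0 := by
  by_cases h0 : p = 0
  · simp [h0]
  have hn : p.natDegree < n := (natDegree_lt_iff_degree_lt h0).2 hp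
  have hcont : Continuous fun x : ℝ => Q.eval x := Q.continuous
  have e : ∀ x : ℝ, p.eval (x : ℂ) * ((Q.eval x : ℝ) : ℂ)
      = ∑ k ∈ Finset.range n, p.coeff k * ((x ^ k * Q.eval x : ℝ) : ℂ) := by
    intro x
    rw [eval_eq_sum_range' hn, Finset.sum_mul]
    refine Finset.sum_congr rfl fun k _ => ?_
    push_cast
    ring
  simp_rw [e]
  rw [integral_finset_sum]
  · refine Finset.sum_eq_zero fun k hk => ?_
    rw [integral_const_mul, integral_complex_ofReal, horth k (Finset.mem_range.1 hk)]
    simp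
  · intro k _
    exact pade_integrable μ a b hnull _ (by fun_prop)

lemma pade_pos (μ : Measure ℝ) [IsFiniteMeasure μ] (a b : ℝ) (hnull : μ (Set.Icc a b)ᶜ = 0)
    (hinf : (measureSupport μ).Infinite) (S : Polynomial ℂ) (hS : S ≠ 0) :
    0 < ∫ x : ℝ, Complex.normSq (S.eval (x : ℂ)) ∂μ := by
  have hc : Continuous fun x : ℝ => Complex.normSq (S.eval (x : ℂ)) :=
    Complex.continuous_normSq.comp (S.continuous.comp Complex.continuous_ofReal)
  have hnn : 0 ≤ fun x : ℝ => Complex.normSq (S.eval (x : ℂ)) :=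
    fun x => Complex.normSq_nonneg _
  refine lt_of_le_of_ne (integral_nonneg hnn) fun h => hinf ?_
  have hae := (integral_eq_zero_iff_of_nonneg hnn
    (pade_integrable μ a b hnull _ hc.continuousOn)).1 h.symm
  have hfin : ((fun x : ℝ => (x : ℂ)) ⁻¹' (S.roots.toFinset : Set ℂ)).Finite :=
    (Finset.finite_toSet _).preimage Complex.ofReal_injective.injOn
  refine hfin.subset fun x hx => ?_
  by_contra hx0
  have hne : S.eval (x : ℂ) ≠ 0 := by
    intro h0
    apply hx0
    simp [hS, h0]
  have ho : IsOpen {y : ℝ | Complex.normSq (S.eval (y : ℂ)) ≠ 0} :=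
    isOpen_ne_fun hc continuous_const
  obtain ⟨ε, hε, hsub⟩ := Metric.isOpen_iff.1 ho x (by simpa using hne)
  have h1 := hx ε hε
  have h2 : μ {y : ℝ | Complex.normSq (S.eval (y : ℂ)) ≠ 0} = 0 := by
    simpa [Filter.EventuallyEq, ae_iff] using hae
  exact h1.ne' (measure_mono_null hsub h2)

/-- **Error formula for Padé approximation to a Markov function.** Let `μ` be a finite positive
Borel measure whose support is an infinite subset of `[a, b]`, let `f(z) = ∫ dμ(x)/(z − x)`,
let `Q` be the monic orthogonal polynomial of degree `n` for `μ`, and let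
`P(z) = ∫ (Q(z) − Q(x))/(z − x) dμ(x)`. Then for `z ∉ [a, b]`, `Q(z) ≠ 0` and
`f(z) − P(z)/Q(z) = (1/Q(z)²) ∫ Q(x)² dμ(x)/(z − x)`. -/
theorem pade_error_formula_markov (μ : Measure ℝ) [IsFiniteMeasure μ] (a b : ℝ)
    (hsupp : measureSupport μ ⊆ Set.Icc a b) (hinf : (measureSupport μ).Infinite)
    (n : ℕ) (Q : Polynomial ℝ) (hmonic : Q.Monic) (hdeg : Q.natDegree = n)
    (horth : ∀ k : ℕ, k < n → ∫ x, x ^ k * Q.eval x ∂μ = 0)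
    (z : ℂ) (hz : z ∉ Complex.ofReal '' Set.Icc a b) :
    aeval z Q ≠ 0 ∧
      (∫ x, (z - (x : ℂ))⁻¹ ∂μ) -
          (∫ x, (aeval z Q - ((Q.eval x : ℝ) : ℂ)) / (z - (x : ℂ)) ∂μ) / aeval z Q
        = (aeval z Q ^ 2)⁻¹ * ∫ x, ((Q.eval x : ℝ) : ℂ) ^ 2 / (z - (x : ℂ)) ∂μ := by
  have hnull := pade_null μ a b hsupp
  set w := aeval z Q with hw
  set Qc : Polynomial ℂ := Q.map (algebraMap ℝ ℂ) with hQc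
  have hQcm : Qc.Monic := hmonic.map _
  have hQcz : Qc.eval z = w := by rw [hQc, eval_map_algebraMap]
  have hQcx : ∀ x : ℝ, Qc.eval (x : ℂ) = ((Q.eval x : ℝ) : ℂ) := by
    intro x
    rw [hQc, eval_map_algebraMap]
    exact aeval_algebraMap_apply_eq_algebraMap_eval x Q
  set S : Polynomial ℂ := Qc /ₘ (X - C z) with hS
  have hSdeg : S.degree < n := by
    have h1 := degree_divByMonic_lt Qc (X - C z) hQcm.ne_zero
      (by rw [degree_X_sub_C]; exact zero_lt_one)
    have h2 : Qc.degree = n := by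
      rw [hQc, degree_map, degree_eq_natDegree hmonic.ne_zero, hdeg]
    rwa [h2] at h1
  have hfac : ∀ x : ℂ, Qc.eval x = w + (x - z) * S.eval x := by
    intro x
    have h := congrArg (Polynomial.eval x) (modByMonic_add_div Qc (X - C z))
    rw [modByMonic_X_sub_C_eq_C_eval, hQcz] at h
    simpa using h.symm
  have hzx : ∀ x ∈ Set.Icc a b, z - (x : ℂ) ≠ 0 := by
    intro x hx h
    exact hz ⟨x, hx, (sub_eq_zero.1 h).symm⟩
  have hae : ∀ᵐ x ∂μ, x ∈ Set.Icc a b := by rw [ae_iff]; exact hnull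
  have hSc : Continuous fun x : ℝ => S.eval (x : ℂ) :=
    S.continuous.comp Complex.continuous_ofReal
  have hQcont : Continuous fun x : ℝ => Q.eval x := Q.continuous
  have hw0 : w ≠ 0 := by
    intro h0
    have hSne : S ≠ 0 := by
      intro hS0
      have : Qc = 0 := by
        apply Polynomial.funext
        intro x
        rw [hfac, h0, hS0]
        simp
      exact hQcm.ne_zero this
    have hpos := pade_pos μ a b hnull hinf S hSne
    set I := ∫ x : ℝ, Complex.normSq (S.eval (x : ℂ)) ∂μ with hI
    set J := ∫ x : ℝ, x * Complex.normSq (S.eval (x : ℂ)) ∂μ with hJ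
    have hnc : Continuous fun x : ℝ => Complex.normSq (S.eval (x : ℂ)) :=
      Complex.continuous_normSq.comp hSc
    have hIi := pade_integrable μ a b hnull _ hnc.continuousOn
    have hJi : Integrable (fun x : ℝ => x * Complex.normSq (S.eval (x : ℂ))) μ :=
      pade_integrable μ a b hnull _ (continuous_id.mul hnc).continuousOn
    have ho := pade_orth μ a b hnull n Q horth (S.map (starRingEnd ℂ))
      (by rwa [degree_map])
    have he : ∀ x : ℝ, (S.map (starRingEnd ℂ)).eval (x : ℂ) * ((Q.eval x : ℝ) : ℂ)
        = ((x * Complex.normSq (S.eval (x : ℂ)) : ℝ) : ℂ)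
          - z * ((Complex.normSq (S.eval (x : ℂ)) : ℝ) : ℂ) := by
      intro x
      have h1 : (S.map (starRingEnd ℂ)).eval (x : ℂ) = (starRingEnd ℂ) (S.eval (x : ℂ)) := by
        have := eval_map_apply (f := starRingEnd ℂ) (p := S) (x : ℂ)
        rwa [Complex.conj_ofReal] at this
      rw [h1, ← hQcx, hfac, h0]
      push_cast
      rw [Complex.normSq_eq_conj_mul_self]
      ring
    simp_rw [he] at ho
    have hIi' : Integrable (fun x : ℝ => ((Complex.normSq (S.eval (x : ℂ)) : ℝ) : ℂ)) μ :=
      hIi.ofReal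
    have hJi' : Integrable (fun x : ℝ => ((x * Complex.normSq (S.eval (x : ℂ)) : ℝ) : ℂ)) μ :=
      hJi.ofReal
    rw [integral_sub hJi' (hIi'.const_mul z), integral_const_mul,
      integral_complex_ofReal, integral_complex_ofReal, ← hI, ← hJ] at ho
    have hlo : a * I ≤ J := by
      rw [hI, hJ, ← integral_const_mul]
      refine integral_mono_ae (hIi.const_mul a) hJi ?_
      filter_upwards [hae] with x hx
      exact mul_le_mul_of_nonneg_right hx.1 (Complex.normSq_nonneg _)
    have hhi : J ≤ b * I := by
      rw [hI, hJ, ← integral_const_mul]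
      refine integral_mono_ae hJi (hIi.const_mul b) ?_
      filter_upwards [hae] with x hx
      exact mul_le_mul_of_nonneg_right hx.2 (Complex.normSq_nonneg _)
    refine hz ⟨J / I, ⟨(le_div_iff₀ hpos).2 hlo, (div_le_iff₀ hpos).2 hhi⟩, ?_⟩
    have hIc : (I : ℂ) ≠ 0 := by exact_mod_cast hpos.ne'
    push_cast
    rw [div_eq_iff hIc]
    exact sub_eq_zero.1 ho
  refine ⟨hw0, ?_⟩
  have i1 : Integrable (fun x : ℝ => (z - (x : ℂ))⁻¹) μ :=
    pade_integrable μ a b hnull _ (ContinuousOn.inv₀ (by fun_prop) hzx)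
  have i2 : Integrable (fun x : ℝ => (w - ((Q.eval x : ℝ) : ℂ)) / (z - (x : ℂ))) μ :=
    pade_integrable μ a b hnull _ (ContinuousOn.div (by fun_prop) (by fun_prop) hzx)
  have i3 : Integrable (fun x : ℝ => ((Q.eval x : ℝ) : ℂ) ^ 2 / (z - (x : ℂ))) μ :=
    pade_integrable μ a b hnull _ (ContinuousOn.div (by fun_prop) (by fun_prop) hzx)
  have ho := pade_orth μ a b hnull n Q horth S hSdeg
  have key : ∫ x : ℝ, S.eval (x : ℂ) * ((Q.eval x : ℝ) : ℂ) ∂μ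
      = w ^ 2 * (∫ x, (z - (x : ℂ))⁻¹ ∂μ)
        - w * (∫ x, (w - ((Q.eval x : ℝ) : ℂ)) / (z - (x : ℂ)) ∂μ)
        - ∫ x, ((Q.eval x : ℝ) : ℂ) ^ 2 / (z - (x : ℂ)) ∂μ := by
    rw [← integral_const_mul, ← integral_const_mul,
      ← integral_sub (i1.const_mul _) (i2.const_mul _),
      ← integral_sub (f := fun x : ℝ => w ^ 2 * (z - (x : ℂ))⁻¹
        - w * ((w - ((Q.eval x : ℝ) : ℂ)) / (z - (x : ℂ))))
        ((i1.const_mul _).sub (i2.const_mul _)) i3]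
    refine integral_congr_ae ?_
    filter_upwards [hae] with x hx
    have h := hzx x hx
    have hf := hfac (x : ℂ)
    rw [hQcx] at hf
    have hs : S.eval (x : ℂ) = (w - ((Q.eval x : ℝ) : ℂ)) / (z - (x : ℂ)) := by
      rw [eq_div_iff h, hf]
      ring
    rw [hs]
    field_simp
    ring
  rw [ho] at key
  generalize (∫ x : ℝ, (z - (x : ℂ))⁻¹ ∂μ) = A at key ⊢
  field_simp
  linear_combination -key
end

section
/- Interlacing of zeros: let μ be a positive Borel measure on ℝ with infinite support contained in a compact interval [a,b] and all moments finite. Let P_n and P_{n+1} be monic real polynomials of degrees n and n+1 respectively with ∫ x^k P_n(x) dμ(x) = 0 for k < n and ∫ x^k P_{n+1}(x) dμ(x) = 0 for k < n+1. Then between any two consecutive real zeros of P_{n+1} there lies exactly one zero of P_n; in particular, if x_1 < x_2 < ⋯ < x_{n+1} are the zeros of P_{n+1} and y_1 < ⋯ < y_n the zeros of P_n, then x_j < y_j < x_{j+1} for all j = 1, …, n. -/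
open MeasureTheory Polynomial

lemma poly_integrable (μ : Measure ℝ) (hmom : ∀ k : ℕ, Integrable (fun x => |x| ^ k) μ)
    (p : Polynomial ℝ) : Integrable (fun x => p.eval x) μ := by
  simp only [Polynomial.eval_eq_sum_range]
  refine integrable_finsetSum _ fun k _ => Integrable.const_mul ?_ _
  refine (hmom k).mono (by fun_prop) (Filter.Eventually.of_forall fun x => ?_)
  simp

lemma poly_orth (μ : Measure ℝ) (hmom : ∀ k : ℕ, Integrable (fun x => |x| ^ k) μ)
    (p : Polynomial ℝ) (m : ℕ) (h : ∀ k : ℕ, k < m → ∫ x, x ^ k * p.eval x ∂μ = 0)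
    (q : Polynomial ℝ) (hq : q.degree < m) : ∫ x, (q * p).eval x ∂μ = 0 := by
  have e : ∀ x : ℝ, (q * p).eval x = ∑ k ∈ Finset.range m, q.coeff k * (x ^ k * p.eval x) := by
    intro x
    by_cases h0 : q = 0
    · simp [h0]
    rw [eval_mul, Polynomial.eval_eq_sum_range' ((natDegree_lt_iff_degree_lt h0).2 hq),
      Finset.sum_mul]
    exact Finset.sum_congr rfl fun k _ => by ring
  simp only [e]
  rw [integral_finsetSum]
  · refine Finset.sum_eq_zero fun k hk => ?_
    rw [integral_const_mul, h k (Finset.mem_range.1 hk), mul_zero]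
  · intro k _
    refine Integrable.const_mul ?_ _
    have := poly_integrable μ hmom (X ^ k * p)
    simp only [eval_mul, eval_pow, eval_X] at this
    exact this

lemma poly_sq_pos (μ : Measure ℝ) (hinf : (measureSupport μ).Infinite)
    (hmom : ∀ k : ℕ, Integrable (fun x => |x| ^ k) μ)
    (p : Polynomial ℝ) (hp : p ≠ 0) : 0 < ∫ x, (p * p).eval x ∂μ := by
  have hnn : 0 ≤ fun x => (p * p).eval x := fun x => by
    simp only [eval_mul]; exact mul_self_nonneg _
  rw [integral_pos_iff_support_of_nonneg hnn (poly_integrable μ hmom _)]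
  obtain ⟨s, hs, hsr⟩ := hinf.exists_notMem_finset p.roots.toFinset
  have hs0 : p.eval s ≠ 0 := by
    intro h; apply hsr; simp [hp, h]
  have ho : IsOpen {x : ℝ | p.eval x ≠ 0} := isOpen_ne_fun p.continuous continuous_const
  obtain ⟨ε, hε, hb⟩ := Metric.isOpen_iff.1 ho s hs0
  refine (hs ε hε).trans_le (measure_mono fun x hx => ?_)
  have := hb hx
  simp only [Set.mem_setOf_eq] at this
  simp [this]

lemma monic_orth_pos (μ : Measure ℝ) (hinf : (measureSupport μ).Infinite)
    (hmom : ∀ k : ℕ, Integrable (fun x => |x| ^ k) μ) (n : ℕ) (P Q L : Polynomial ℝ) (t : ℝ)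
    (hP : P.Monic) (hPd : P.natDegree = n) (hL : L.Monic) (hLd : L.natDegree = n)
    (hQ : Q = (X - C t) * L) (hLt : L.eval t ≠ 0)
    (horthn : ∀ k : ℕ, k < n → ∫ x, x ^ k * P.eval x ∂μ = 0)
    (horthn1 : ∀ k : ℕ, k < n + 1 → ∫ x, x ^ k * Q.eval x ∂μ = 0) :
    0 < P.eval t * L.eval t := by
  have hI := poly_integrable μ hmom
  have hdP : P.degree = n := by rw [degree_eq_natDegree hP.ne_zero, hPd]
  have hdL : L.degree = n := by rw [degree_eq_natDegree hL.ne_zero, hLd]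
  have h1 : ∫ x, (L * P).eval x ∂μ = ∫ x, (P * P).eval x ∂μ := by
    have hd : (L - P).degree < n := by
      have := degree_sub_lt_left (hdL.trans hdP.symm) hL.ne_zero (by rw [hL, hP])
      rwa [hdL] at this
    have := poly_orth μ hmom P n horthn (L - P) hd
    rw [sub_mul] at this
    simp only [eval_sub] at this
    rw [integral_sub (hI _) (hI _)] at this
    linarith
  have h2 := poly_sq_pos μ hinf hmom P hP.ne_zero
  have h3 := poly_sq_pos μ hinf hmom L hL.ne_zero
  set c := P.eval t / L.eval t with hc
  obtain ⟨q, hq⟩ : (X - C t) ∣ P - C c * L := by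
    rw [dvd_iff_isRoot]; simp [hc, hLt]
  have hqd : q.degree < (n + 1 : ℕ) := by
    by_cases q0 : q = 0
    · simp [q0, WithBot.bot_lt_coe]
    rw [← natDegree_lt_iff_degree_lt q0]
    have e : (P - C c * L).natDegree ≤ n := by
      refine (natDegree_sub_le _ _).trans (max_le hPd.le ?_)
      exact (natDegree_C_mul_le _ _).trans hLd.le
    rw [hq, natDegree_mul (X_sub_C_ne_zero t) q0] at e
    omega
  have h4 := poly_orth μ hmom Q (n + 1) horthn1 q hqd
  have e4 : q * Q = L * P - C c * (L * L) := by
    rw [hQ, show q * ((X - C t) * L) = ((X - C t) * q) * L by ring, ← hq]; ring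
  rw [e4] at h4
  simp only [eval_sub, eval_C_mul] at h4
  rw [integral_sub (hI _) ((hI _).const_mul c), integral_const_mul, h1] at h4
  have hcpos : 0 < c := by
    by_contra hcn
    nlinarith
  have : P.eval t * L.eval t = c * (L.eval t * L.eval t) := by rw [hc]; field_simp
  rw [this]
  exact mul_pos hcpos (mul_self_pos.2 hLt)

/-- **Interlacing of zeros.** Let `μ` be a positive Borel measure with infinite support contained
in `[a, b]` and all moments finite, and let `Pₙ` and `Pₙ₊₁` be the monic orthogonal polynomials
of degrees `n` and `n + 1` for `μ`. If `x₁ < ⋯ < x_{n+1}` are the zeros of `Pₙ₊₁` and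
`y₁ < ⋯ < yₙ` the zeros of `Pₙ`, then `x_j < y_j < x_{j+1}` for all `j = 1, …, n`. -/
theorem interlacing_of_zeros (μ : Measure ℝ) (a b : ℝ)
    (hsupp : measureSupport μ ⊆ Set.Icc a b) (hinf : (measureSupport μ).Infinite)
    (hmom : ∀ k : ℕ, Integrable (fun x => |x| ^ k) μ)
    (n : ℕ) (Pn Pn1 : Polynomial ℝ)
    (hPnmonic : Pn.Monic) (hPndeg : Pn.natDegree = n)
    (hPn1monic : Pn1.Monic) (hPn1deg : Pn1.natDegree = n + 1)
    (horthn : ∀ k : ℕ, k < n → ∫ x, x ^ k * Pn.eval x ∂μ = 0)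
    (horthn1 : ∀ k : ℕ, k < n + 1 → ∫ x, x ^ k * Pn1.eval x ∂μ = 0)
    (x : Fin (n + 1) → ℝ) (y : Fin n → ℝ) (hx : StrictMono x) (hy : StrictMono y)
    (hxroots : Pn1 = ∏ i, (X - C (x i))) (hyroots : Pn = ∏ i, (X - C (y i))) :
    ∀ j : Fin n, x j.castSucc < y j ∧ y j < x j.succ := by
  classical
  set L : Fin (n + 1) → Polynomial ℝ := fun i => ∏ k ∈ Finset.univ.erase i, (X - C (x k)) with hL
  have hLe : ∀ i t, (L i).eval t = ∏ k ∈ Finset.univ.erase i, (t - x k) := by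
    intro i t; simp [hL, eval_prod]
  have hLt : ∀ i, (L i).eval (x i) ≠ 0 := by
    intro i
    rw [hLe, Finset.prod_ne_zero_iff]
    intro k hk
    exact sub_ne_zero.2 (hx.injective.ne (Finset.ne_of_mem_erase hk).symm)
  have hpos : ∀ i, 0 < Pn.eval (x i) * (L i).eval (x i) := by
    intro i
    refine monic_orth_pos μ hinf hmom n Pn Pn1 (L i) (x i) hPnmonic hPndeg
      (monic_prod_of_monic _ _ fun k _ => monic_X_sub_C _) ?_ ?_ (hLt i) horthn horthn1
    · rw [hL]
      simp only
      rw [natDegree_prod_of_monic _ _ fun k _ => monic_X_sub_C _]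
      simp
    · rw [hxroots]
      exact (Finset.mul_prod_erase Finset.univ (fun k => X - C (x k)) (Finset.mem_univ i)).symm
  have hadj : ∀ j : Fin n, (L j.castSucc).eval (x j.castSucc) * (L j.succ).eval (x j.succ) < 0 := by
    intro j
    have hne : j.castSucc ≠ j.succ := (Fin.castSucc_lt_succ).ne
    have hlt : x j.castSucc < x j.succ := hx Fin.castSucc_lt_succ
    rw [hLe, hLe,
      ← Finset.mul_prod_erase (Finset.univ.erase j.castSucc) _
        (Finset.mem_erase.2 ⟨hne.symm, Finset.mem_univ _⟩),
      ← Finset.mul_prod_erase (Finset.univ.erase j.succ) _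
        (Finset.mem_erase.2 ⟨hne, Finset.mem_univ _⟩),
      Finset.erase_right_comm (a := j.succ), mul_mul_mul_comm, ← Finset.prod_mul_distrib]
    refine mul_neg_of_neg_of_pos (mul_neg_of_neg_of_pos (by linarith) (by linarith)) ?_
    refine Finset.prod_pos fun k hk => ?_
    simp only [Finset.mem_erase, Finset.mem_univ, and_true] at hk
    rcases lt_or_gt_of_ne hk.2 with h | h
    · have h' : k < j.succ := h.trans Fin.castSucc_lt_succ
      exact mul_pos (sub_pos.2 (hx h)) (sub_pos.2 (hx h'))
    · have h' : j.succ < k := by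
        refine lt_of_le_of_ne ?_ hk.1.symm
        rw [Fin.le_def]; rw [Fin.lt_def] at h; simp at h ⊢; omega
      exact mul_pos_of_neg_of_neg (sub_neg.2 (hx h)) (sub_neg.2 (hx h'))
  have hroot : ∀ j : Fin n, ∃ m : Fin n, x j.castSucc < y m ∧ y m < x j.succ := by
    intro j
    have hlt : x j.castSucc < x j.succ := hx Fin.castSucc_lt_succ
    have h1 := hpos j.castSucc
    have h2 := hpos j.succ
    have h3 := hadj j
    have h4 : Pn.eval (x j.castSucc) * Pn.eval (x j.succ) < 0 := by
      by_contra hc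
      push Not at hc
      have := mul_pos h1 h2
      nlinarith [mul_nonneg hc (neg_pos.2 h3).le]
    have key : ∃ t ∈ Set.Ioo (x j.castSucc) (x j.succ), Pn.eval t = 0 := by
      rcases mul_neg_iff.1 h4 with ⟨u, v⟩ | ⟨u, v⟩
      · exact intermediate_value_Ioo' hlt.le Pn.continuous.continuousOn ⟨v, u⟩
      · exact intermediate_value_Ioo hlt.le Pn.continuous.continuousOn ⟨u, v⟩
    obtain ⟨t, ht, h0⟩ := key
    rw [hyroots, eval_prod, Finset.prod_eq_zero_iff] at h0
    obtain ⟨m, -, hm⟩ := h0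
    have : t = y m := by simpa [sub_eq_zero] using hm
    exact ⟨m, this ▸ ht.1, this ▸ ht.2⟩
  choose σ h1 h2 using hroot
  have hσ : StrictMono σ := by
    intro i j hij
    rw [← hy.lt_iff_lt]
    refine (h2 i).trans_le ((hx.monotone ?_).trans (h1 j).le)
    rw [Fin.le_def]; rw [Fin.lt_def] at hij; simp; omega
  intro j
  have : σ j = j := le_antisymm hσ.apply_le hσ.le_apply
  have a1 := h1 j
  have a2 := h2 j
  rw [this] at a1 a2
  exact ⟨a1, a2⟩
end

section
/- Gauss quadrature: let μ be a positive Borel measure on ℝ with infinite support contained in a compact interval [a,b] and all moments finite, let P_n be the monic polynomial of degree n with ∫ x^k P_n(x) dμ(x) = 0 for k < n, and let x_1 < x_2 < ⋯ < x_n be its zeros (which are real, simple, and lie in (a,b)). Then there exist strictly positive real numbers λ_1, …, λ_n such that for every polynomial π with real coefficients of degree ≤ 2n − 1, ∫ π(x) dμ(x) = ∑_{k=1}^n λ_k π(x_k). -/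
open MeasureTheory Polynomial

lemma gq_integrable (μ : Measure ℝ) (hmom : ∀ k : ℕ, Integrable (fun x => |x| ^ k) μ)
    (p : Polynomial ℝ) : Integrable (fun t => p.eval t) μ := by
  simp only [eval_eq_sum_range]
  refine integrable_finsetSum _ fun k _ => Integrable.const_mul ?_ _
  refine (hmom k).mono' (by fun_prop) (Filter.Eventually.of_forall fun t => ?_)
  simp

lemma gq_orth (μ : Measure ℝ) (hmom : ∀ k : ℕ, Integrable (fun x => |x| ^ k) μ)
    (n : ℕ) (P : Polynomial ℝ)
    (horth : ∀ k : ℕ, k < n → ∫ x, x ^ k * P.eval x ∂μ = 0)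
    (q : Polynomial ℝ) (hq : q.natDegree < n) : ∫ t, (P * q).eval t ∂μ = 0 := by
  have h : ∀ t : ℝ, (P * q).eval t
      = ∑ k ∈ Finset.range (q.natDegree + 1), q.coeff k * (t ^ k * P.eval t) := by
    intro t
    rw [eval_mul, eval_eq_sum_range (p := q), Finset.mul_sum]
    exact Finset.sum_congr rfl fun k _ => by ring
  simp only [h]
  rw [integral_finsetSum]
  · refine Finset.sum_eq_zero fun k hk => ?_
    rw [integral_const_mul, horth k (by have := Finset.mem_range.1 hk; omega), mul_zero]
  · intro k _
    refine Integrable.const_mul ?_ _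
    have he : (fun t : ℝ => t ^ k * P.eval t) = fun t => (X ^ k * P).eval t := by
      funext t
      rw [eval_mul, eval_pow, eval_X]
    rw [he]
    exact gq_integrable μ hmom (X ^ k * P)

lemma gq_pos (μ : Measure ℝ) (hinf : (measureSupport μ).Infinite)
    (hmom : ∀ k : ℕ, Integrable (fun x => |x| ^ k) μ)
    (p : Polynomial ℝ) (hp : p ≠ 0) : 0 < ∫ t, (p * p).eval t ∂μ := by
  rw [integral_pos_iff_support_of_nonneg]
  · obtain ⟨y, hy, hy'⟩ := hinf.exists_notMem_finset p.roots.toFinset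
    have hy2 : p.eval y ≠ 0 := by simpa [hp] using hy'
    have ho : IsOpen (Function.support fun t => (p * p).eval t) :=
      isOpen_ne_fun (by fun_prop) (by fun_prop)
    obtain ⟨ε, he, hb⟩ := Metric.isOpen_iff.1 ho y (by simpa using hy2)
    exact (hy ε he).trans_le (measure_mono hb)
  · intro t
    simpa using mul_self_nonneg (p.eval t)
  · exact gq_integrable μ hmom _

/-- **Gauss quadrature.** Let `μ` be a positive Borel measure with infinite support contained in
`[a, b]` and all moments finite, let `P` be the monic orthogonal polynomial of degree `n` for
`μ`, and let `x₁ < ⋯ < xₙ` be its zeros (real, simple, in `(a, b)`). Then there exist strictly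
positive weights `λ₁, …, λₙ` such that `∫ π dμ = ∑ₖ λₖ π(xₖ)` for every real polynomial `π`
of degree ≤ 2n − 1. -/
theorem gauss_quadrature (μ : Measure ℝ) (a b : ℝ)
    (hsupp : measureSupport μ ⊆ Set.Icc a b) (hinf : (measureSupport μ).Infinite)
    (hmom : ∀ k : ℕ, Integrable (fun x => |x| ^ k) μ)
    (n : ℕ) (P : Polynomial ℝ) (hmonic : P.Monic) (hdeg : P.natDegree = n)
    (horth : ∀ k : ℕ, k < n → ∫ x, x ^ k * P.eval x ∂μ = 0)
    (x : Fin n → ℝ) (hx : StrictMono x) (hxab : ∀ i, x i ∈ Set.Ioo a b)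
    (hroots : P = ∏ i, (X - C (x i))) :
    ∃ lam : Fin n → ℝ, (∀ k, 0 < lam k) ∧
      ∀ π : Polynomial ℝ, π.degree < (2 * n : ℕ) →
        ∫ t, π.eval t ∂μ = ∑ k, lam k * π.eval (x k) := by
  have hinj : Set.InjOn x (Finset.univ : Finset (Fin n)) := hx.injective.injOn
  have main : ∀ π : Polynomial ℝ, π.degree < (2 * n : ℕ) →
      ∫ t, π.eval t ∂μ
        = ∑ k, (∫ t, (Lagrange.basis Finset.univ x k).eval t ∂μ) * π.eval (x k) := by
    intro π hπ
    rcases Nat.eq_zero_or_pos n with h0 | hn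
    · subst h0
      have : π = 0 := by simpa using hπ
      simp [this]
    have hq : (π /ₘ P).natDegree < n := by
      rw [natDegree_divByMonic _ hmonic, hdeg]
      have : π.natDegree < 2 * n := by
        by_cases h : π = 0
        · simp [h, hn]
        · exact (natDegree_lt_iff_degree_lt h).2 hπ
      omega
    have hPx : ∀ k, P.eval (x k) = 0 := by
      intro k
      rw [hroots, eval_prod]
      exact Finset.prod_eq_zero (Finset.mem_univ k) (by simp)
    have hr : (π %ₘ P).degree < (Finset.univ : Finset (Fin n)).card := by
      have := degree_modByMonic_lt π hmonic
      rw [degree_eq_natDegree hmonic.ne_zero, hdeg] at this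
      simpa using this
    have hre : ∀ k, (π %ₘ P).eval (x k) = π.eval (x k) := by
      intro k
      conv_rhs => rw [← modByMonic_add_div π P]
      simp [hPx]
    have hint := Lagrange.eq_interpolate hinj hr
    calc ∫ t, π.eval t ∂μ = ∫ t, ((π %ₘ P).eval t + (P * (π /ₘ P)).eval t) ∂μ := by
          simp only [← eval_add, modByMonic_add_div]
      _ = ∫ t, (π %ₘ P).eval t ∂μ := by
          rw [integral_add (gq_integrable μ hmom _) (gq_integrable μ hmom _),
            gq_orth μ hmom n P horth _ hq, add_zero]
      _ = ∫ t, ∑ k, (Lagrange.basis Finset.univ x k).eval t * π.eval (x k) ∂μ := by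
          refine integral_congr_ae (Filter.Eventually.of_forall fun t => ?_)
          simp only
          rw [hint, Lagrange.interpolate_apply, eval_finsetSum]
          refine Finset.sum_congr rfl fun k _ => ?_
          rw [eval_mul, eval_C, hre, mul_comm]
      _ = _ := by
          rw [integral_finsetSum]
          · exact Finset.sum_congr rfl fun k _ => integral_mul_const _ _
          · exact fun k _ => (gq_integrable μ hmom _).mul_const _
  refine ⟨_, fun k => ?_, main⟩
  have hne := Lagrange.basis_ne_zero hinj (Finset.mem_univ k)
  have hp := gq_pos μ hinf hmom _ hne
  have hd := Lagrange.degree_basis hinj (Finset.mem_univ k)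
  rw [main] at hp
  · rw [Finset.sum_eq_single k] at hp
    · simpa [Lagrange.eval_basis_self hinj (Finset.mem_univ k)] using hp
    · intro j _ hj
      simp [Lagrange.eval_basis_of_ne hj.symm (Finset.mem_univ j)]
    · simp
  · have hn : 0 < n := k.pos
    rw [degree_mul, hd, ← Nat.cast_add]
    simp only [Finset.card_univ, Fintype.card_fin]
    exact Nat.cast_lt.2 (by omega)
end

section
/- Markov's theorem: let μ be a positive finite Borel measure on ℝ whose support is an infinite subset of a compact interval [a,b], let f(z) = ∫ dμ(x)/(z − x), and for each n let Q_n be the monic orthogonal polynomial of degree n for μ (∫ x^k Q_n dμ = 0 for k < n) and P_{n−1}(z) = ∫ (Q_n(z) − Q_n(x))/(z − x) dμ(x). Then the sequence of rational functions P_{n−1}/Q_n converges to f uniformly on every compact subset of ℂ \ [a,b]. -/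
open MeasureTheory Polynomial Filter

lemma mk_null (μ : Measure ℝ) (a b : ℝ) (hsupp : measureSupport μ ⊆ Set.Icc a b) :
    ∀ᵐ x ∂μ, x ∈ Set.Icc a b := by
  rw [ae_iff]
  apply measure_null_of_locally_null
  intro x hx
  have hx' : x ∉ measureSupport μ := fun h => hx (hsupp h)
  simp only [measureSupport, Set.mem_ofPred_eq, not_forall, not_lt, nonpos_iff_eq_zero] at hx'
  obtain ⟨ε, hε, h0⟩ := hx'
  exact ⟨Metric.ball x ε, mem_nhdsWithin_of_mem_nhds (Metric.ball_mem_nhds x hε), h0⟩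

lemma mk_int (μ : Measure ℝ) [IsFiniteMeasure μ] (a b : ℝ)
    (hae : ∀ᵐ x ∂μ, x ∈ Set.Icc a b) {E : Type*} [NormedAddCommGroup E]
    (f : ℝ → E) (hf : ContinuousOn f (Set.Icc a b)) : Integrable f μ := by
  have h := hf.integrableOn_compact (μ := μ) isCompact_Icc
  rwa [IntegrableOn, Measure.restrict_eq_self_of_ae_mem hae] at h

lemma mk_orth (μ : Measure ℝ) [IsFiniteMeasure μ] (a b : ℝ)
    (hae : ∀ᵐ x ∂μ, x ∈ Set.Icc a b) (Q : Polynomial ℝ) (n : ℕ)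
    (horth : ∀ k : ℕ, k < n → ∫ x, x ^ k * Q.eval x ∂μ = 0)
    (h : Polynomial ℂ) (hn : h.natDegree < n) :
    ∫ x : ℝ, h.eval (x : ℂ) * ((Q.eval x : ℝ) : ℂ) ∂μ = 0 := by
  simp_rw [eval_eq_sum_range' hn, Finset.sum_mul]
  rw [integral_finsetSum]
  · apply Finset.sum_eq_zero
    intro k hk
    have h1 := horth k (Finset.mem_range.1 hk)
    have h2 : ∀ x : ℝ, h.coeff k * (x : ℂ) ^ k * ((Q.eval x : ℝ) : ℂ)
        = h.coeff k * ((x ^ k * Q.eval x : ℝ) : ℂ) := by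
      intro x; push_cast; ring
    simp_rw [h2]
    rw [integral_const_mul, integral_complex_ofReal, h1]
    simp
  · intro k hk
    apply mk_int μ a b hae
    have := Q.continuous
    fun_prop

lemma mk_conj (e : Polynomial ℂ) (x : ℝ) :
    (e.map (starRingEnd ℂ)).eval (x : ℂ) = (starRingEnd ℂ) (e.eval (x : ℂ)) := by
  have := Polynomial.eval_map_apply (starRingEnd ℂ) (p := e) (x : ℂ)
  rw [Complex.conj_ofReal] at this
  exact this

/-- coercivity -/
lemma mk_coer (μ : Measure ℝ) [IsFiniteMeasure μ] (a b : ℝ)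
    (hae : ∀ᵐ x ∂μ, x ∈ Set.Icc a b) (z c : ℂ) (hc : ‖c‖ = 1) (δ : ℝ)
    (hcz : ∀ x ∈ Set.Icc a b, δ ≤ (c * (z - (x : ℂ))).re) (e : Polynomial ℂ) :
    δ * ∫ x : ℝ, ‖e.eval (x : ℂ)‖ ^ 2 ∂μ ≤
      ‖∫ x : ℝ, (z - (x : ℂ)) * e.eval (x : ℂ) * (starRingEnd ℂ) (e.eval (x : ℂ)) ∂μ‖ := by
  have he : Continuous (fun x : ℝ => e.eval (x : ℂ)) := e.continuous.comp Complex.continuous_ofReal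
  have hi : Integrable (fun x : ℝ =>
      c * ((z - (x : ℂ)) * e.eval (x : ℂ) * (starRingEnd ℂ) (e.eval (x : ℂ)))) μ := by
    apply mk_int μ a b hae
    fun_prop
  calc δ * ∫ x : ℝ, ‖e.eval (x : ℂ)‖ ^ 2 ∂μ
      = ∫ x : ℝ, δ * ‖e.eval (x : ℂ)‖ ^ 2 ∂μ := (integral_const_mul _ _).symm
    _ ≤ ∫ x : ℝ, (c * ((z - (x : ℂ)) * e.eval (x : ℂ) *
          (starRingEnd ℂ) (e.eval (x : ℂ)))).re ∂μ := by
        apply integral_mono_ae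
        · apply mk_int μ a b hae
          fun_prop
        · exact hi.re
        · filter_upwards [hae] with x hx
          have h1 : c * ((z - (x : ℂ)) * e.eval (x : ℂ) * (starRingEnd ℂ) (e.eval (x : ℂ)))
              = (c * (z - (x : ℂ))) * ((‖e.eval (x : ℂ)‖ ^ 2 : ℝ) : ℂ) := by
            rw [mul_assoc (z - (x : ℂ)), Complex.mul_conj, Complex.normSq_eq_norm_sq]
            ring
          simp only [h1, Complex.re_mul_ofReal]
          exact mul_le_mul_of_nonneg_right (hcz x hx) (sq_nonneg _)
    _ = (∫ x : ℝ, c * ((z - (x : ℂ)) * e.eval (x : ℂ) *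
          (starRingEnd ℂ) (e.eval (x : ℂ))) ∂μ).re := integral_re hi
    _ ≤ _ := by
        rw [integral_const_mul]
        refine (Complex.re_le_norm _).trans ?_
        rw [norm_mul, hc, one_mul]

lemma mk_zero (μ : Measure ℝ) [IsFiniteMeasure μ] (a b : ℝ)
    (hae : ∀ᵐ x ∂μ, x ∈ Set.Icc a b) (hinf : (measureSupport μ).Infinite)
    (e : Polynomial ℂ) (h : ∫ x : ℝ, ‖e.eval (x : ℂ)‖ ^ 2 ∂μ ≤ 0) : e = 0 := by
  by_contra hne
  have he : Continuous (fun x : ℝ => e.eval (x : ℂ)) := e.continuous.comp Complex.continuous_ofReal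
  have hi : Integrable (fun x : ℝ => ‖e.eval (x : ℂ)‖ ^ 2) μ := by
    apply mk_int μ a b hae
    fun_prop
  have h0 : ∫ x : ℝ, ‖e.eval (x : ℂ)‖ ^ 2 ∂μ = 0 :=
    le_antisymm h (integral_nonneg fun x => sq_nonneg _)
  rw [integral_eq_zero_iff_of_nonneg (fun x => sq_nonneg _) hi] at h0
  have hfin : {x : ℝ | e.eval (x : ℂ) = 0}.Finite := by
    have := (Polynomial.finite_setOfPred_isRoot hne).preimage
      (f := Complex.ofReal) (Complex.ofReal_injective.injOn)
    exact this
  obtain ⟨x, hx, hx0⟩ := hinf.exists_notMem_finite hfin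
  obtain ⟨ε, hε, hb⟩ := Metric.isOpen_iff.1 (isOpen_ne_fun he continuous_const) x hx0
  have := hx ε hε
  have h2 : μ (Metric.ball x ε) = 0 := by
    refine measure_mono_null ?_ (ae_iff.1 h0)
    intro y hy
    simpa using hb hy
  exact this.ne' h2

lemma mk_main (μ : Measure ℝ) [IsFiniteMeasure μ] (a b : ℝ)
    (hae : ∀ᵐ x ∂μ, x ∈ Set.Icc a b) (hinf : (measureSupport μ).Infinite)
    (Q : Polynomial ℝ) (n : ℕ) (hmonic : Q.Monic) (hdeg : Q.natDegree = n)
    (horth : ∀ k : ℕ, k < n → ∫ x, x ^ k * Q.eval x ∂μ = 0)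
    (z c : ℂ) (hc : ‖c‖ = 1) (δ ε : ℝ) (hδ : 0 < δ) (hε : 0 < ε)
    (hcz : ∀ x ∈ Set.Icc a b, δ ≤ (c * (z - (x : ℂ))).re)
    (p : Polynomial ℂ) (hp : p.natDegree < n)
    (hpz : ∀ x ∈ Set.Icc a b, ‖1 - (z - (x : ℂ)) * p.eval (x : ℂ)‖ ≤ ε) :
    ‖(∫ x : ℝ, (z - (x : ℂ))⁻¹ ∂μ) -
      (∫ x : ℝ, (aeval z Q - ((Q.eval x : ℝ) : ℂ)) / (z - (x : ℂ)) ∂μ) / aeval z Q‖ ≤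
      2 * (ε / δ) * μ.real Set.univ := by
  have hzn : ∀ x ∈ Set.Icc a b, δ ≤ ‖z - (x : ℂ)‖ := by
    intro x hx
    have := (hcz x hx).trans (Complex.re_le_norm _)
    rwa [norm_mul, hc, one_mul] at this
  have hz0 : ∀ x ∈ Set.Icc a b, z - (x : ℂ) ≠ 0 := by
    intro x hx h
    have := hzn x hx
    rw [h, norm_zero] at this
    linarith
  set q : Polynomial ℂ := Q.map (algebraMap ℝ ℂ) with hq
  have hqm : q.Monic := hmonic.map _
  have hqd : q.natDegree = n := by rw [hq, natDegree_map, hdeg]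
  have hqz : aeval z Q = q.eval z := by rw [hq, eval_map_algebraMap]
  have hqx : ∀ x : ℝ, ((Q.eval x : ℝ) : ℂ) = q.eval (x : ℂ) := by
    intro x
    exact (Polynomial.eval_map_apply (algebraMap ℝ ℂ) (p := Q) x).symm
  set r : Polynomial ℂ := q /ₘ (X - C z) with hr
  have hrq : ∀ w : ℂ, (w - z) * r.eval w = q.eval w - q.eval z := by
    intro w
    have := congrArg (eval w) (X_sub_C_mul_divByMonic_eq_sub_modByMonic q z)
    simpa [modByMonic_X_sub_C_eq_C_eval] using this
  have hrd : r.natDegree < n := by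
    rw [hr, natDegree_divByMonic _ (monic_X_sub_C z), hqd, natDegree_X_sub_C]
    omega
  have horthC : ∀ h : Polynomial ℂ, h.natDegree < n →
      ∫ x : ℝ, q.eval (x : ℂ) * (starRingEnd ℂ) (h.eval (x : ℂ)) ∂μ = 0 := by
    intro h hh
    have := mk_orth μ a b hae Q n horth (h.map (starRingEnd ℂ)) (by rwa [natDegree_map])
    rw [← this]
    congr 1 with x
    rw [mk_conj, hqx, mul_comm]
  have hq0 : q.eval z ≠ 0 := by
    intro h0
    have h1 := mk_coer μ a b hae z c hc δ hcz r
    have h2 : ∫ x : ℝ, (z - (x : ℂ)) * r.eval (x : ℂ) * (starRingEnd ℂ) (r.eval (x : ℂ)) ∂μ = 0 := by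
      rw [← neg_eq_zero, ← integral_neg, ← horthC r hrd]
      congr 1 with x
      have := hrq x
      rw [h0, sub_zero] at this
      rw [← this]; ring
    rw [h2, norm_zero] at h1
    have h3 : r = 0 := mk_zero μ a b hae hinf r (by
      by_contra! h
      have := mul_pos hδ h
      linarith)
    have h4 : q = 0 := by
      have := X_sub_C_mul_divByMonic_eq_sub_modByMonic q z
      rw [modByMonic_X_sub_C_eq_C_eval, h0, ← hr, h3] at this
      simpa using this.symm
    exact hqm.ne_zero h4
  set e : Polynomial ℂ := C (q.eval z)⁻¹ * r - p with he
  have hed : e.natDegree < n :=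
    (natDegree_sub_le _ _).trans_lt (max_lt ((natDegree_C_mul_le _ _).trans_lt hrd) hp)
  have hcont : ∀ s : Polynomial ℂ, Continuous (fun x : ℝ => s.eval (x : ℂ)) :=
    fun s => s.continuous.comp Complex.continuous_ofReal
  have hec := hcont e
  have hpc := hcont p
  have hqc := hcont q
  have hze : ∀ x : ℝ, (z - (x : ℂ)) * e.eval (x : ℂ) =
      (1 - (z - (x : ℂ)) * p.eval (x : ℂ)) - (q.eval z)⁻¹ * q.eval (x : ℂ) := by
    intro x
    have h1 : (z - (x : ℂ)) * r.eval (x : ℂ) = q.eval z - q.eval (x : ℂ) := by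
      linear_combination -(hrq x)
    have h2 : (q.eval z)⁻¹ * q.eval z = 1 := inv_mul_cancel₀ hq0
    simp only [he, eval_sub, eval_mul, eval_C]
    linear_combination (q.eval z)⁻¹ * h1 + h2
  have hgal : ∫ x : ℝ, (z - (x : ℂ)) * e.eval (x : ℂ) * (starRingEnd ℂ) (e.eval (x : ℂ)) ∂μ =
      ∫ x : ℝ, (1 - (z - (x : ℂ)) * p.eval (x : ℂ)) * (starRingEnd ℂ) (e.eval (x : ℂ)) ∂μ := by
    have h1 : ∀ x : ℝ, (z - (x : ℂ)) * e.eval (x : ℂ) * (starRingEnd ℂ) (e.eval (x : ℂ)) =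
        (1 - (z - (x : ℂ)) * p.eval (x : ℂ)) * (starRingEnd ℂ) (e.eval (x : ℂ)) -
        (q.eval z)⁻¹ * (q.eval (x : ℂ) * (starRingEnd ℂ) (e.eval (x : ℂ))) := by
      intro x; rw [hze]; ring
    simp_rw [h1]
    rw [integral_sub, integral_const_mul, horthC e hed, mul_zero, sub_zero]
    · apply mk_int μ a b hae
      fun_prop
    · apply mk_int μ a b hae
      fun_prop
  have hi1 : Integrable (fun x : ℝ => ‖e.eval (x : ℂ)‖) μ := by
    apply mk_int μ a b hae
    fun_prop
  have hi2 : Integrable (fun x : ℝ => ‖e.eval (x : ℂ)‖ ^ 2) μ := by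
    apply mk_int μ a b hae
    fun_prop
  have hA : δ * ∫ x : ℝ, ‖e.eval (x : ℂ)‖ ^ 2 ∂μ ≤ ε * ∫ x : ℝ, ‖e.eval (x : ℂ)‖ ∂μ := by
    refine (mk_coer μ a b hae z c hc δ hcz e).trans ?_
    rw [hgal, ← integral_const_mul]
    apply norm_integral_le_of_norm_le (hi1.const_mul ε)
    filter_upwards [hae] with x hx
    rw [norm_mul, RCLike.norm_conj]
    exact mul_le_mul_of_nonneg_right (hpz x hx) (norm_nonneg _)
  set s := ε / δ with hs
  have hspos : 0 < s := div_pos hε hδ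
  have hB : ∫ x : ℝ, ‖e.eval (x : ℂ)‖ ^ 2 ∂μ ≤ s * ∫ x : ℝ, ‖e.eval (x : ℂ)‖ ∂μ := by
    rw [hs, div_mul_eq_mul_div, le_div_iff₀ hδ]
    linarith
  have hCC : 2 * s * (∫ x : ℝ, ‖e.eval (x : ℂ)‖ ∂μ) - s ^ 2 * μ.real Set.univ
      ≤ ∫ x : ℝ, ‖e.eval (x : ℂ)‖ ^ 2 ∂μ := by
    have h1 : ∫ x : ℝ, (2 * s * ‖e.eval (x : ℂ)‖ - s ^ 2) ∂μ
        ≤ ∫ x : ℝ, ‖e.eval (x : ℂ)‖ ^ 2 ∂μ := by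
      apply integral_mono ((hi1.const_mul _).sub (integrable_const _)) hi2
      intro x
      show 2 * s * ‖e.eval (x : ℂ)‖ - s ^ 2 ≤ ‖e.eval (x : ℂ)‖ ^ 2
      nlinarith [sq_nonneg (‖e.eval (x : ℂ)‖ - s)]
    rw [integral_sub (hi1.const_mul _) (integrable_const _), integral_const_mul,
      integral_const, smul_eq_mul] at h1
    linarith
  have hE : ∫ x : ℝ, ‖e.eval (x : ℂ)‖ ∂μ ≤ s * μ.real Set.univ := by
    have : s * (∫ x : ℝ, ‖e.eval (x : ℂ)‖ ∂μ) ≤ s * (s * μ.real Set.univ) := by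
      nlinarith
    exact le_of_mul_le_mul_left this hspos
  have hP : (∫ x : ℝ, (aeval z Q - ((Q.eval x : ℝ) : ℂ)) / (z - (x : ℂ)) ∂μ) / aeval z Q
      = ∫ x : ℝ, (p.eval (x : ℂ) + e.eval (x : ℂ)) ∂μ := by
    rw [← integral_div]
    apply integral_congr_ae
    filter_upwards [hae] with x hx
    rw [hqz, hqx]
    have h1 : (z - (x : ℂ)) * r.eval (x : ℂ) = q.eval z - q.eval (x : ℂ) := by
      linear_combination -(hrq x)
    rw [← h1, mul_div_cancel_left₀ _ (hz0 x hx)]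
    simp only [he, eval_sub, eval_mul, eval_C]
    ring
  have hinvI : Integrable (fun x : ℝ => (z - (x : ℂ))⁻¹) μ := by
    apply mk_int μ a b hae
    apply ContinuousOn.inv₀ _ hz0
    fun_prop
  have hpI : Integrable (fun x : ℝ => p.eval (x : ℂ)) μ := mk_int μ a b hae _ hpc.continuousOn
  have heI : Integrable (fun x : ℝ => e.eval (x : ℂ)) μ := mk_int μ a b hae _ hec.continuousOn
  have hpeI : Integrable (fun x : ℝ => p.eval (x : ℂ) + e.eval (x : ℂ)) μ := hpI.add heI
  rw [hP, ← integral_sub hinvI hpeI]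
  have hfin : ‖∫ x : ℝ, ((z - (x : ℂ))⁻¹ - (p.eval (x : ℂ) + e.eval (x : ℂ))) ∂μ‖ ≤
      ∫ x : ℝ, (s + ‖e.eval (x : ℂ)‖) ∂μ := by
    apply norm_integral_le_of_norm_le ((integrable_const _).add hi1)
    filter_upwards [hae] with x hx
    have h1 : (z - (x : ℂ))⁻¹ - (p.eval (x : ℂ) + e.eval (x : ℂ)) =
        (1 - (z - (x : ℂ)) * p.eval (x : ℂ)) / (z - (x : ℂ)) - e.eval (x : ℂ) := by
      have := hz0 x hx
      field_simp
      ring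
    rw [h1]
    refine (norm_sub_le _ _).trans ?_
    refine add_le_add ?_ le_rfl
    rw [norm_div]
    exact div_le_div₀ hε.le (hpz x hx) hδ (hzn x hx)
  refine hfin.trans ?_
  rw [integral_add (integrable_const _) hi1, integral_const, smul_eq_mul]
  linarith

lemma mk_dir (a b : ℝ) (hab : a ≤ b) (z : ℂ) (hz : z ∉ Complex.ofReal '' Set.Icc a b) :
    ∃ c : ℂ, ‖c‖ = 1 ∧ ∃ δ > 0, ∀ x ∈ Set.Icc a b, δ ≤ (c * (z - (x : ℂ))).re := by
  rcases lt_trichotomy z.im 0 with h | h | h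
  · refine ⟨Complex.I, by simp, -z.im, by linarith, fun x hx => by simp⟩
  · have hre : z = (z.re : ℂ) := by
      apply Complex.ext <;> simp [h]
    have h1 : ¬ (a ≤ z.re ∧ z.re ≤ b) := fun hh => hz ⟨z.re, hh, hre.symm⟩
    by_cases h2 : a ≤ z.re
    · have h3 : b < z.re := by
        by_contra! h3
        exact h1 ⟨h2, h3⟩
      refine ⟨1, by simp, z.re - b, by linarith, fun x hx => ?_⟩
      simp only [one_mul, Complex.sub_re, Complex.ofReal_re]
      linarith [hx.2]
    · refine ⟨-1, by simp, a - z.re, by linarith, fun x hx => ?_⟩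
      simp only [neg_mul, one_mul, Complex.sub_re, Complex.ofReal_re, Complex.neg_re]
      linarith [hx.1]
  · refine ⟨-Complex.I, by simp, z.im, by linarith, fun x hx => by simp⟩

lemma mk_approx (a b : ℝ) (f : ℝ → ℂ) (hf : ContinuousOn f (Set.Icc a b)) (ε : ℝ) (hε : 0 < ε) :
    ∃ p : Polynomial ℂ, ∀ x ∈ Set.Icc a b, ‖f x - p.eval (x : ℂ)‖ ≤ ε := by
  obtain ⟨u, hu⟩ := exists_polynomial_near_of_continuousOn a b (fun x => (f x).re)
    (Complex.continuous_re.comp_continuousOn hf) (ε / 2) (by linarith)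
  obtain ⟨v, hv⟩ := exists_polynomial_near_of_continuousOn a b (fun x => (f x).im)
    (Complex.continuous_im.comp_continuousOn hf) (ε / 2) (by linarith)
  refine ⟨u.map (algebraMap ℝ ℂ) + C Complex.I * v.map (algebraMap ℝ ℂ), fun x hx => ?_⟩
  have hx1 : ∀ w : Polynomial ℝ, (w.map (algebraMap ℝ ℂ)).eval (x : ℂ) = ((w.eval x : ℝ) : ℂ) :=
    fun w => Polynomial.eval_map_apply (algebraMap ℝ ℂ) (p := w) x
  refine (Complex.norm_le_abs_re_add_abs_im _).trans ?_
  have h1 := hu x hx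
  have h2 := hv x hx
  rw [abs_sub_comm] at h1 h2
  simp only [eval_add, eval_mul, eval_C, hx1, Complex.sub_re, Complex.add_re, Complex.ofReal_re,
    Complex.mul_re, Complex.I_re, Complex.I_im, Complex.ofReal_im, Complex.sub_im, Complex.add_im,
    Complex.mul_im, zero_mul, one_mul, mul_zero, sub_zero, add_zero, zero_add]
  linarith

/-- **Markov's theorem.** Let `μ` be a finite positive Borel measure whose support is an infinite
subset of `[a, b]`, `f(z) = ∫ dμ(x)/(z − x)`, `Qₙ` the monic orthogonal polynomial of degree `n`
for `μ`, and `Pₙ₋₁(z) = ∫ (Qₙ(z) − Qₙ(x))/(z − x) dμ(x)`. Then `Pₙ₋₁/Qₙ → f` uniformly on every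
compact subset of `ℂ \ [a, b]`. -/
theorem markov_theorem (μ : Measure ℝ) [IsFiniteMeasure μ] (a b : ℝ)
    (hsupp : measureSupport μ ⊆ Set.Icc a b) (hinf : (measureSupport μ).Infinite)
    (Q : ℕ → Polynomial ℝ)
    (hmonic : ∀ n, (Q n).Monic) (hdeg : ∀ n, (Q n).natDegree = n)
    (horth : ∀ n, ∀ k : ℕ, k < n → ∫ x, x ^ k * (Q n).eval x ∂μ = 0)
    (P : ℕ → ℂ → ℂ)
    (hP : ∀ n (z : ℂ),
      P n z = ∫ x, (aeval z (Q n) - (((Q n).eval x : ℝ) : ℂ)) / (z - (x : ℂ)) ∂μ) :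
    ∀ K : Set ℂ, IsCompact K → K ⊆ (Complex.ofReal '' Set.Icc a b)ᶜ →
      TendstoUniformlyOn (fun n z => P n z / aeval z (Q n))
        (fun z => ∫ x, (z - (x : ℂ))⁻¹ ∂μ) atTop K := by
  intro K hK hKs
  have hae := mk_null μ a b hsupp
  have hab : a ≤ b := by
    obtain ⟨x, hx⟩ := hinf.nonempty
    exact (hsupp hx).1.trans (hsupp hx).2
  rw [← tendstoLocallyUniformlyOn_iff_tendstoUniformlyOn_of_compact hK,
    Metric.tendstoLocallyUniformlyOn_iff]
  intro η hη z₀ hz₀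
  obtain ⟨c, hc, δ, hδ, hcz⟩ := mk_dir a b hab z₀ (hKs hz₀)
  have hM : 0 ≤ μ.real Set.univ := measureReal_nonneg
  set M := μ.real Set.univ with hMdef
  -- target accuracy
  set ε := η * (δ / 2) / (4 * (M + 1)) with hεdef
  have hε : 0 < ε := by positivity
  have hzn : ∀ x ∈ Set.Icc a b, δ ≤ ‖z₀ - (x : ℂ)‖ := by
    intro x hx
    have := (hcz x hx).trans (Complex.re_le_norm _)
    rwa [norm_mul, hc, one_mul] at this
  have hz0 : ∀ x ∈ Set.Icc a b, z₀ - (x : ℂ) ≠ 0 := by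
    intro x hx h
    have := hzn x hx
    rw [h, norm_zero] at this
    linarith
  obtain ⟨B, hB⟩ := (isCompact_Icc (a := a) (b := b)).exists_bound_of_continuousOn
    (f := fun x : ℝ => z₀ - (x : ℂ)) (by fun_prop)
  have hB0 : 0 ≤ B := (norm_nonneg _).trans (hB a ⟨le_rfl, hab⟩)
  obtain ⟨p, hp⟩ := mk_approx a b (fun x : ℝ => (z₀ - (x : ℂ))⁻¹)
    (ContinuousOn.inv₀ (by fun_prop) hz0) (ε / 2 / (B + 1)) (by positivity)
  obtain ⟨D, hD⟩ := (isCompact_Icc (a := a) (b := b)).exists_bound_of_continuousOn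
    (f := fun x : ℝ => p.eval (x : ℂ)) (p.continuous.comp Complex.continuous_ofReal).continuousOn
  have hD0 : 0 ≤ D := (norm_nonneg _).trans (hD a ⟨le_rfl, hab⟩)
  have hρ : 0 < min (δ / 2) (ε / 2 / (D + 1)) := by positivity
  refine ⟨Metric.ball z₀ (min (δ / 2) (ε / 2 / (D + 1))),
    mem_nhdsWithin_of_mem_nhds (Metric.ball_mem_nhds _ hρ), ?_⟩
  filter_upwards [eventually_gt_atTop p.natDegree] with n hn z hz
  rw [Metric.mem_ball, dist_eq_norm, lt_min_iff] at hz
  rw [dist_eq_norm, hP]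
  refine (mk_main μ a b hae hinf (Q n) n (hmonic n) (hdeg n) (horth n) z c hc (δ / 2) ε
    (by linarith) hε ?_ p hn ?_).trans_lt ?_
  · intro x hx
    have h1 : c * (z - (x : ℂ)) = c * (z₀ - (x : ℂ)) + c * (z - z₀) := by ring
    have h2 : |(c * (z - z₀)).re| ≤ ‖z - z₀‖ := by
      refine (Complex.abs_re_le_norm _).trans ?_
      rw [norm_mul, hc, one_mul]
    rw [h1, Complex.add_re]
    linarith [hcz x hx, (abs_le.1 h2).1, hz.1]
  · intro x hx
    have h1 : 1 - (z - (x : ℂ)) * p.eval (x : ℂ) =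
        (z₀ - (x : ℂ)) * ((z₀ - (x : ℂ))⁻¹ - p.eval (x : ℂ)) - (z - z₀) * p.eval (x : ℂ) := by
      rw [mul_sub, mul_inv_cancel₀ (hz0 x hx)]
      ring
    have h2 : ‖(z₀ - (x : ℂ)) * ((z₀ - (x : ℂ))⁻¹ - p.eval (x : ℂ))‖ ≤ ε / 2 := by
      rw [norm_mul]
      calc _ ≤ (B + 1) * (ε / 2 / (B + 1)) := by
            gcongr
            · linarith [hB x hx]
            · exact hp x hx
        _ = ε / 2 := by field_simp
    have h3 : ‖(z - z₀) * p.eval (x : ℂ)‖ ≤ ε / 2 := by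
      rw [norm_mul]
      calc _ ≤ (ε / 2 / (D + 1)) * (D + 1) := by
            gcongr
            · exact hz.2.le
            · linarith [hD x hx]
        _ = ε / 2 := by field_simp
    rw [h1]
    refine (norm_sub_le _ _).trans ?_
    linarith
  · rw [← hMdef]
    have : 2 * (ε / (δ / 2)) * M = η * (M / (2 * (M + 1))) := by
      rw [hεdef]
      field_simp
      norm_num
    rw [this]
    have h5 : M / (2 * (M + 1)) < 1 := by
      rw [div_lt_one (by positivity)]
      linarith
    nlinarith
end

section
/- Hermite's integrals for e: for every natural number n, there exist integers a_n and b_n such that ∫₀¹ (x^n (1−x)^n / n!) e^x dx = a_n · e + b_n, and moreover 0 < a_n · e + b_n ≤ e / (4^n · n!). -/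
open Polynomial in
theorem hermite_aux (n : ℕ) : ∃ a b : ℤ,
    (∫ x in (0 : ℝ)..1, x ^ n * (1 - x) ^ n / (n.factorial : ℝ) * Real.exp x)
      = (a : ℝ) * Real.exp 1 + (b : ℝ) := by
  set p : ℤ[X] := X ^ n * (1 - X) ^ n with hp
  obtain ⟨g, -, hg⟩ := aeval_sumIDeriv (A := ℤ) p n
  have h0 := hg 0 (by simp [hp])
  have h1 := hg 1 (by
    have : (1 - X : ℤ[X]) = (X - C 1) * (-1) := by simp
    rw [hp, this, mul_pow]
    simp only [Algebra.algebraMap_self, Polynomial.map_id]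
    exact Dvd.dvd.mul_left (Dvd.intro _ rfl) _)
  simp only [coe_aeval_eq_eval, nsmul_eq_mul] at h0 h1
  refine ⟨g.eval 0, -g.eval 1, ?_⟩
  set S : ℝ[X] := (sumIDeriv p).map (Int.castRingHom ℝ) with hS
  have hS' : S = p.map (Int.castRingHom ℝ) + derivative S := by
    rw [hS, derivative_map, ← Polynomial.map_add, ← sumIDeriv_eq_self_add]
  have e0 : S.eval 0 = n.factorial * (g.eval 0 : ℤ) := by
    have : S.eval ((0 : ℤ) : ℝ) = ((sumIDeriv p).eval 0 : ℤ) := by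
      rw [hS, eval_intCast_map]; simp
    rw [h0] at this
    simpa using this
  have e1 : S.eval 1 = n.factorial * (g.eval 1 : ℤ) := by
    have : S.eval ((1 : ℤ) : ℝ) = ((sumIDeriv p).eval 1 : ℤ) := by
      rw [hS, eval_intCast_map]; simp
    rw [h1] at this
    simpa using this
  have hn : (n.factorial : ℝ) ≠ 0 := by positivity
  have hsub := intervalIntegral.integral_comp_sub_left (a := 0) (b := 1)
    (fun x : ℝ => x ^ n * (1 - x) ^ n / (n.factorial : ℝ) * Real.exp x) 1
  simp only [sub_zero, sub_self, sub_sub_cancel] at hsub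
  rw [← hsub, intervalIntegral.integral_eq_sub_of_hasDerivAt
    (f := fun x => -(Real.exp (1 - x) * S.eval x) / n.factorial)]
  · simp only [e0, e1]
    simp
    field_simp
    ring
  · intro x _
    have hd := ((((hasDerivAt_id x).const_sub 1).exp.mul (S.hasDerivAt x)).neg).div_const
      (n.factorial : ℝ)
    refine hd.congr_deriv ?_
    have : S.eval x = x ^ n * (1 - x) ^ n + (derivative S).eval x := by
      conv_lhs => rw [hS']
      simp [hp]
    rw [this]
    simp
    field_simp
    ring
  · exact Continuous.intervalIntegrable (by fun_prop) _ _

/-- **Hermite's integrals for `e`.** For every natural number `n` there are integers `aₙ, bₙ`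
with `∫₀¹ (xⁿ(1−x)ⁿ/n!) eˣ dx = aₙ e + bₙ`, and `0 < aₙ e + bₙ ≤ e / (4ⁿ n!)`. -/
theorem hermite_integrals_for_e (n : ℕ) :
    ∃ a b : ℤ,
      (∫ x in (0 : ℝ)..1, x ^ n * (1 - x) ^ n / (n.factorial : ℝ) * Real.exp x)
          = (a : ℝ) * Real.exp 1 + (b : ℝ) ∧
      0 < (a : ℝ) * Real.exp 1 + (b : ℝ) ∧
      (a : ℝ) * Real.exp 1 + (b : ℝ) ≤ Real.exp 1 / (4 ^ n * (n.factorial : ℝ)) := by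
  obtain ⟨a, b, h⟩ := hermite_aux n
  have hc : Continuous
    (fun x : ℝ => x ^ n * (1 - x) ^ n / (n.factorial : ℝ) * Real.exp x) := by fun_prop
  refine ⟨a, b, h, ?_, ?_⟩ <;> rw [← h]
  · refine intervalIntegral.intervalIntegral_pos_of_pos_on (hc.intervalIntegrable _ _) ?_ one_pos
    rintro x ⟨hx0, hx1⟩
    have : 0 < 1 - x := by linarith
    positivity
  · have key := intervalIntegral.integral_mono_on (μ := MeasureTheory.volume) zero_le_one
      (hc.intervalIntegrable 0 1)
      (continuous_const (y := Real.exp 1 / (4 ^ n * (n.factorial : ℝ))).intervalIntegrable 0 1)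
      (by
        rintro x ⟨hx0, hx1⟩
        have h1 : 0 ≤ 1 - x := by linarith
        have h2 : x ^ n * (1 - x) ^ n ≤ (1 / 4) ^ n := by
          rw [← mul_pow]
          exact pow_le_pow_left₀ (by positivity) (by nlinarith [sq_nonneg (2 * x - 1)]) n
        have h3 : Real.exp x ≤ Real.exp 1 := Real.exp_le_exp.2 hx1
        calc x ^ n * (1 - x) ^ n / (n.factorial : ℝ) * Real.exp x
            ≤ (1 / 4) ^ n / (n.factorial : ℝ) * Real.exp 1 := by gcongr
          _ = _ := by rw [one_div, inv_pow]; field_simp)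
    simpa using key
end

section
/- The double integral ∫₀¹ ∫₀¹ 1/(1 − xy) dx dy converges and equals ∑_{k=1}^∞ 1/k² = π²/6. -/
open MeasureTheory

lemma aux_sum : HasSum (fun k : ℕ => 1 / ((k : ℝ) + 1) ^ 2) (Real.pi ^ 2 / 6) := by
  have h := (hasSum_nat_add_iff' 1).mpr hasSum_zeta_two
  simpa using h

lemma aux_int (k : ℕ) : IntegrableOn (fun x : ℝ => x ^ k) (Set.Ioo 0 1) volume :=
  ((continuous_pow k).integrableOn_Icc (a := 0) (b := 1)).mono_set Set.Ioo_subset_Icc_self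

lemma aux_val (k : ℕ) : ∫ x in Set.Ioo (0 : ℝ) 1, x ^ k = 1 / ((k : ℝ) + 1) := by
  rw [← integral_Ioc_eq_integral_Ioo, ← intervalIntegral.integral_of_le zero_le_one,
    integral_pow]
  simp

lemma aux_lint (k : ℕ) :
    ∫⁻ p in Set.Ioo (0 : ℝ) 1 ×ˢ Set.Ioo (0 : ℝ) 1, ENNReal.ofReal ((p.1 * p.2) ^ k)
      = ENNReal.ofReal (1 / ((k : ℝ) + 1) ^ 2) := by
  have hi : IntegrableOn (fun p : ℝ × ℝ => (p.1 * p.2) ^ k)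
      (Set.Ioo (0 : ℝ) 1 ×ˢ Set.Ioo (0 : ℝ) 1) volume := by
    simp only [mul_pow]
    rw [IntegrableOn, Measure.volume_eq_prod, ← Measure.prod_restrict]
    exact (aux_int k).mul_prod (aux_int k)
  rw [← ofReal_integral_eq_lintegral_ofReal hi]
  · congr 1
    simp only [mul_pow]
    rw [Measure.volume_eq_prod, ← Measure.prod_restrict,
      integral_prod_mul (fun x : ℝ => x ^ k) (fun x : ℝ => x ^ k), aux_val]
    rw [← sq, div_pow, one_pow]
  · filter_upwards [ae_restrict_mem (measurableSet_Ioo.prod measurableSet_Ioo)] with p hp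
    exact pow_nonneg (mul_nonneg hp.1.1.le hp.2.1.le) k

lemma aux_mem {p : ℝ × ℝ} (hp : p ∈ Set.Ioo (0 : ℝ) 1 ×ˢ Set.Ioo (0 : ℝ) 1) :
    0 ≤ p.1 * p.2 ∧ p.1 * p.2 < 1 :=
  ⟨mul_nonneg hp.1.1.le hp.2.1.le, mul_lt_one_of_nonneg_of_lt_one_left hp.1.1.le hp.1.2 hp.2.2.le⟩

lemma aux_main :
    ∫⁻ p in Set.Ioo (0 : ℝ) 1 ×ˢ Set.Ioo (0 : ℝ) 1, ENNReal.ofReal ((1 - p.1 * p.2)⁻¹)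
      = ENNReal.ofReal (Real.pi ^ 2 / 6) := by
  have h1 : ∫⁻ p in Set.Ioo (0 : ℝ) 1 ×ˢ Set.Ioo (0 : ℝ) 1, ENNReal.ofReal ((1 - p.1 * p.2)⁻¹)
      = ∫⁻ p in Set.Ioo (0 : ℝ) 1 ×ˢ Set.Ioo (0 : ℝ) 1,
          ∑' k : ℕ, ENNReal.ofReal ((p.1 * p.2) ^ k) := by
    refine setLIntegral_congr_fun (measurableSet_Ioo.prod measurableSet_Ioo) fun p hp => ?_
    obtain ⟨h0, h1⟩ := aux_mem hp
    have hs := hasSum_geometric_of_lt_one h0 h1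
    rw [← hs.tsum_eq, ENNReal.ofReal_tsum_of_nonneg (fun k => pow_nonneg h0 k) hs.summable]
  rw [h1, lintegral_tsum (fun k => by fun_prop)]
  simp only [aux_lint]
  rw [← aux_sum.tsum_eq, ENNReal.ofReal_tsum_of_nonneg (fun k => by positivity) aux_sum.summable]

/-- **The Beukers integral for ζ(2).** The double integral `∫₀¹∫₀¹ 1/(1 − xy) dx dy` converges
and equals `∑_{k≥1} 1/k² = π²/6`. -/
theorem beukers_integral_zeta_two :
    IntegrableOn (fun p : ℝ × ℝ => (1 - p.1 * p.2)⁻¹)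
        (Set.Ioo (0 : ℝ) 1 ×ˢ Set.Ioo (0 : ℝ) 1) volume ∧
      (∫ p in Set.Ioo (0 : ℝ) 1 ×ˢ Set.Ioo (0 : ℝ) 1, (1 - p.1 * p.2)⁻¹)
          = ∑' k : ℕ, 1 / ((k : ℝ) + 1) ^ 2 ∧
      (∑' k : ℕ, 1 / ((k : ℝ) + 1) ^ 2) = Real.pi ^ 2 / 6 := by
  have hm : Measurable (fun p : ℝ × ℝ => (1 - p.1 * p.2)⁻¹) := by fun_prop
  have hnn : 0 ≤ᵐ[volume.restrict (Set.Ioo (0 : ℝ) 1 ×ˢ Set.Ioo (0 : ℝ) 1)]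
      (fun p : ℝ × ℝ => (1 - p.1 * p.2)⁻¹) := by
    filter_upwards [ae_restrict_mem (measurableSet_Ioo.prod measurableSet_Ioo)] with p hp
    exact inv_nonneg.mpr (sub_nonneg.mpr (aux_mem hp).2.le)
  refine ⟨⟨hm.aestronglyMeasurable, ?_⟩, ?_, aux_sum.tsum_eq⟩
  · rw [hasFiniteIntegral_iff_ofReal hnn, aux_main]
    exact ENNReal.ofReal_lt_top
  · rw [integral_eq_lintegral_of_nonneg_ae hnn hm.aestronglyMeasurable, aux_main,
      aux_sum.tsum_eq, ENNReal.toReal_ofReal (by positivity)]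
end

section
/- The double integral ∫₀¹ ∫₀¹ (−log(xy))/(1 − xy) dx dy converges and equals 2 ∑_{k=1}^∞ 1/k³ = 2 ζ(3). -/
open MeasureTheory

lemma bk_pow (k : ℕ) : IntegrableOn (fun x : ℝ => x ^ k) (Set.Ioo 0 1) volume ∧
    ∫ x in Set.Ioo (0:ℝ) 1, x ^ k = 1 / ((k:ℝ) + 1) := by
  constructor
  · have h : IntervalIntegrable (fun x : ℝ => x ^ k) volume 0 1 :=
      (continuous_pow k).intervalIntegrable _ _
    exact (intervalIntegrable_iff_integrableOn_Ioo_of_le zero_le_one).1 h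
  · rw [← integral_Ioc_eq_integral_Ioo, ← intervalIntegral.integral_of_le zero_le_one, integral_pow]
    simp

lemma bk_log (k : ℕ) : IntegrableOn (fun x : ℝ => x ^ k * Real.log x) (Set.Ioo 0 1) volume ∧
    ∫ x in Set.Ioo (0:ℝ) 1, x ^ k * Real.log x = - (1 / ((k:ℝ) + 1) ^ 2) := by
  have h : IntervalIntegrable (fun x : ℝ => x ^ k * Real.log x) volume 0 1 :=
    intervalIntegral.intervalIntegrable_log'.continuousOn_mul (continuous_pow k).continuousOn
  refine ⟨(intervalIntegrable_iff_integrableOn_Ioo_of_le zero_le_one).1 h, ?_⟩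
  rw [← integral_Ioc_eq_integral_Ioo, ← intervalIntegral.integral_of_le zero_le_one]
  have hk : (k:ℝ) + 1 ≠ 0 := by positivity
  rw [intervalIntegral.integral_eq_sub_of_hasDerivAt_of_le
    (f := fun x : ℝ => x ^ k * (x * Real.log x) / (k + 1) - x ^ (k + 1) / ((k:ℝ) + 1) ^ 2)
    zero_le_one ?_ ?_ h]
  · simp
  · have := Real.continuous_mul_log
    exact Continuous.continuousOn (by fun_prop)
  · intro x hx
    have hx0 : x ≠ 0 := hx.1.ne'
    have h1 : HasDerivAt (fun x : ℝ => x ^ (k + 1)) (((k:ℝ) + 1) * x ^ k) x := by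
      simpa using hasDerivAt_pow (k + 1) x
    have h2 := ((h1.mul (Real.hasDerivAt_log hx0)).div_const ((k:ℝ) + 1)).sub
      (h1.div_const (((k:ℝ) + 1) ^ 2))
    convert h2 using 1
    · funext y
      simp [pow_succ, mul_assoc]
    · field_simp
      ring

lemma bk_term (k : ℕ) :
    IntegrableOn (fun p : ℝ × ℝ => (p.1 * p.2) ^ k * (-Real.log (p.1 * p.2)))
      (Set.Ioo (0 : ℝ) 1 ×ˢ Set.Ioo (0 : ℝ) 1) volume ∧
    ∫ p in Set.Ioo (0 : ℝ) 1 ×ˢ Set.Ioo (0 : ℝ) 1, (p.1 * p.2) ^ k * (-Real.log (p.1 * p.2))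
      = 2 * (1 / ((k:ℝ) + 1) ^ 3) := by
  have hS : MeasurableSet (Set.Ioo (0 : ℝ) 1 ×ˢ Set.Ioo (0 : ℝ) 1) :=
    measurableSet_Ioo.prod measurableSet_Ioo
  have e : Set.EqOn (fun p : ℝ × ℝ => -(p.1 ^ k * Real.log p.1 * p.2 ^ k
      + p.1 ^ k * (p.2 ^ k * Real.log p.2)))
      (fun p : ℝ × ℝ => (p.1 * p.2) ^ k * (-Real.log (p.1 * p.2)))
      (Set.Ioo (0 : ℝ) 1 ×ˢ Set.Ioo (0 : ℝ) 1) := by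
    rintro ⟨x, y⟩ ⟨hx, hy⟩
    simp only
    rw [Real.log_mul hx.1.ne' hy.1.ne']
    ring
  obtain ⟨ip, vp⟩ := bk_pow k
  obtain ⟨il, vl⟩ := bk_log k
  have hm : (volume : Measure (ℝ × ℝ)).restrict (Set.Ioo (0 : ℝ) 1 ×ˢ Set.Ioo (0 : ℝ) 1)
      = (volume.restrict (Set.Ioo (0:ℝ) 1)).prod (volume.restrict (Set.Ioo (0:ℝ) 1)) := by
    rw [Measure.prod_restrict]; rfl
  have i1 := Integrable.mul_prod il ip
  have i2 := Integrable.mul_prod ip il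
  constructor
  · refine IntegrableOn.congr_fun ?_ e hS
    rw [IntegrableOn, hm]
    exact (i1.add i2).neg
  · rw [← setIntegral_congr_fun hS e, hm, integral_neg, integral_add i1 i2,
      integral_prod_mul (fun x : ℝ => x ^ k * Real.log x) (fun x : ℝ => x ^ k),
      integral_prod_mul (fun x : ℝ => x ^ k) (fun x : ℝ => x ^ k * Real.log x), vp, vl]
    have hk : (k:ℝ) + 1 ≠ 0 := by positivity
    field_simp
    ring

/-- **The Beukers integral for ζ(3).** The double integral
`∫₀¹∫₀¹ (−log(xy))/(1 − xy) dx dy` converges and equals `2 ∑_{k≥1} 1/k³ = 2 ζ(3)`. -/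
theorem beukers_integral_zeta_three :
    IntegrableOn (fun p : ℝ × ℝ => -Real.log (p.1 * p.2) / (1 - p.1 * p.2))
        (Set.Ioo (0 : ℝ) 1 ×ˢ Set.Ioo (0 : ℝ) 1) volume ∧
      (∫ p in Set.Ioo (0 : ℝ) 1 ×ˢ Set.Ioo (0 : ℝ) 1, -Real.log (p.1 * p.2) / (1 - p.1 * p.2))
          = 2 * ∑' k : ℕ, 1 / ((k : ℝ) + 1) ^ 3 := by
  have hS : MeasurableSet (Set.Ioo (0 : ℝ) 1 ×ˢ Set.Ioo (0 : ℝ) 1) :=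
    measurableSet_Ioo.prod measurableSet_Ioo
  have bnd : ∀ p ∈ Set.Ioo (0 : ℝ) 1 ×ˢ Set.Ioo (0 : ℝ) 1,
      0 < p.1 * p.2 ∧ p.1 * p.2 < 1 ∧ 0 ≤ -Real.log (p.1 * p.2) := by
    rintro ⟨x, y⟩ ⟨hx, hy⟩
    have h0 : 0 < x * y := mul_pos hx.1 hy.1
    have h1 : x * y < 1 := mul_lt_one_of_nonneg_of_lt_one_left hx.1.le hx.2 hy.2.le
    exact ⟨h0, h1, neg_nonneg.2 (Real.log_nonpos h0.le h1.le)⟩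
  have hsum : Summable (fun k : ℕ => 2 * (1 / ((k : ℝ) + 1) ^ 3)) := by
    have := (summable_nat_add_iff 1).2 (Real.summable_one_div_nat_pow.2 (by norm_num : 1 < 3))
    refine Summable.mul_left 2 ?_
    simpa using this
  have hnn : 0 ≤ᵐ[volume.restrict (Set.Ioo (0 : ℝ) 1 ×ˢ Set.Ioo (0 : ℝ) 1)]
      (fun p : ℝ × ℝ => -Real.log (p.1 * p.2) / (1 - p.1 * p.2)) := by
    filter_upwards [ae_restrict_mem hS] with p hp
    obtain ⟨_, h1, h2⟩ := bnd p hp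
    exact div_nonneg h2 (sub_nonneg.2 h1.le)
  have hmeas : AEStronglyMeasurable
      (fun p : ℝ × ℝ => -Real.log (p.1 * p.2) / (1 - p.1 * p.2))
      (volume.restrict (Set.Ioo (0 : ℝ) 1 ×ˢ Set.Ioo (0 : ℝ) 1)) := by
    apply Measurable.aestronglyMeasurable
    fun_prop
  have key : ∫⁻ p in Set.Ioo (0 : ℝ) 1 ×ˢ Set.Ioo (0 : ℝ) 1,
      ENNReal.ofReal (-Real.log (p.1 * p.2) / (1 - p.1 * p.2))
      = ENNReal.ofReal (∑' k : ℕ, 2 * (1 / ((k : ℝ) + 1) ^ 3)) := by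
    have e : Set.EqOn
        (fun p : ℝ × ℝ => ENNReal.ofReal (-Real.log (p.1 * p.2) / (1 - p.1 * p.2)))
        (fun p : ℝ × ℝ => ∑' k : ℕ, ENNReal.ofReal ((p.1 * p.2) ^ k * (-Real.log (p.1 * p.2))))
        (Set.Ioo (0 : ℝ) 1 ×ˢ Set.Ioo (0 : ℝ) 1) := by
      intro p hp
      obtain ⟨h0, h1, h2⟩ := bnd p hp
      have hs := (hasSum_geometric_of_lt_one h0.le h1).mul_right (-Real.log (p.1 * p.2))
      simp only
      rw [← ENNReal.ofReal_tsum_of_nonneg (fun k => by positivity) hs.summable, hs.tsum_eq,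
        div_eq_inv_mul]
    rw [setLIntegral_congr_fun hS e, lintegral_tsum (fun k => by fun_prop),
      ENNReal.ofReal_tsum_of_nonneg (fun k => by positivity) hsum]
    congr 1
    funext k
    rw [← (bk_term k).2, ofReal_integral_eq_lintegral_ofReal (bk_term k).1]
    filter_upwards [ae_restrict_mem hS] with p hp
    obtain ⟨h0, h1, h2⟩ := bnd p hp
    exact mul_nonneg (pow_nonneg h0.le k) h2
  constructor
  · refine ⟨hmeas, ?_⟩
    rw [hasFiniteIntegral_iff_ofReal hnn, key]
    exact ENNReal.ofReal_lt_top
  · rw [integral_eq_lintegral_of_nonneg_ae hnn hmeas, key,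
      ENNReal.toReal_ofReal (tsum_nonneg fun k => by positivity), tsum_mul_left]
end

section
/- Apéry's theorem: the number ζ(3) = ∑_{k=1}^∞ 1/k³ is irrational. -/
namespace Apery

noncomputable def lam (n k : ℕ) : ℝ := (n.choose k : ℝ) * ((n + k).choose k : ℝ)

noncomputable def cc (n k : ℕ) : ℝ :=
  ∑ m ∈ Finset.range n, 1 / ((m : ℝ) + 1) ^ 3 +
    ∑ m ∈ Finset.range k, (-1 : ℝ) ^ m / (2 * ((m : ℝ) + 1) ^ 3 * lam n (m + 1))

noncomputable def bb (n : ℕ) : ℝ := ∑ k ∈ Finset.range (n + 1), lam n k ^ 2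

noncomputable def aa (n : ℕ) : ℝ := ∑ k ∈ Finset.range (n + 1), lam n k ^ 2 * cc n k

lemma lam_pos {n k : ℕ} (h : k ≤ n) : 0 < lam n k := by
  unfold lam
  have h1 : 0 < n.choose k := Nat.choose_pos h
  have h2 : 0 < (n + k).choose k := Nat.choose_pos (by omega)
  positivity

lemma lam_nonneg (n k : ℕ) : 0 ≤ lam n k := by unfold lam; positivity

lemma lam_eq_zero {n k : ℕ} (h : n < k) : lam n k = 0 := by
  simp [lam, Nat.choose_eq_zero_of_lt h]

lemma lam_zero (n : ℕ) : lam n 0 = 1 := by simp [lam]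

lemma lam_L1 (n k : ℕ) : lam (n + 1) k * ((n : ℝ) + 1 - k) = lam n k * ((n : ℝ) + 1 + k) := by
  rcases Nat.lt_or_ge (n + 1) k with h | h
  · rw [lam_eq_zero h, lam_eq_zero (by omega : n < k)]; simp
  · have h1 : (n.choose k : ℝ) * ((n : ℝ) + 1) = ((n + 1).choose k : ℝ) * ((n : ℝ) + 1 - k) := by
      have := Nat.choose_mul_succ_eq n k
      have h' : ((n.choose k * (n + 1) : ℕ) : ℝ) = (((n + 1).choose k * (n + 1 - k) : ℕ) : ℝ) := by
        rw [this]
      rw [Nat.cast_mul, Nat.cast_mul, Nat.cast_sub h] at h'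
      push_cast at h'
      exact h'
    have h2 : ((n + k).choose k : ℝ) * ((n : ℝ) + k + 1)
        = ((n + 1 + k).choose k : ℝ) * ((n : ℝ) + 1) := by
      have := Nat.choose_mul_succ_eq (n + k) k
      rw [show n + k + 1 - k = n + 1 by omega, show n + k + 1 = n + 1 + k by omega] at this
      have h' : (((n + k).choose k * (n + 1 + k) : ℕ) : ℝ)
        = (((n + 1 + k).choose k * (n + 1) : ℕ) : ℝ) := by rw [this]
      push_cast at h'
      linarith
    have hn : ((n : ℝ) + 1) ≠ 0 := by positivity
    unfold lam
    apply mul_left_cancel₀ hn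
    linear_combination (-((n + 1 + k).choose k : ℝ) * ((n : ℝ) + 1)) * h1
      - (n.choose k : ℝ) * (n + 1) * h2

lemma lam_L3 (n j : ℕ) : lam (n + 1) (j + 1) * ((j : ℝ) + 1) ^ 2
    = lam n j * ((n : ℝ) + j + 2) * ((n : ℝ) + j + 1) := by
  have h1 : ((n : ℝ) + 1) * (n.choose j : ℝ) = ((n + 1).choose (j + 1) : ℝ) * ((j : ℝ) + 1) := by
    exact_mod_cast Nat.add_one_mul_choose_eq n j
  have h2 : ((n : ℝ) + j + 2) * ((n + j + 1).choose j : ℝ)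
      = ((n + 1 + (j + 1)).choose (j + 1) : ℝ) * ((j : ℝ) + 1) := by
    have := Nat.add_one_mul_choose_eq (n + j + 1) j
    rw [show n + j + 1 + 1 = n + 1 + (j + 1) by omega] at this
    have h' : (((n + 1 + (j + 1)) * (n + j + 1).choose j : ℕ) : ℝ)
        = (((n + 1 + (j + 1)).choose (j + 1) * (j + 1) : ℕ) : ℝ) := by rw [this]
    push_cast at h'
    linarith
  have h3 : ((n + j).choose j : ℝ) * ((n : ℝ) + j + 1)
        = ((n + j + 1).choose j : ℝ) * ((n : ℝ) + 1) := by
    have := Nat.choose_mul_succ_eq (n + j) j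
    rw [show n + j + 1 - j = n + 1 by omega] at this
    exact_mod_cast this
  have hn : ((n : ℝ) + 1) ≠ 0 := by positivity
  unfold lam
  apply mul_left_cancel₀ hn
  linear_combination (-((n + 1 + (j + 1)).choose (j + 1) : ℝ) * ((j : ℝ) + 1) * ((n : ℝ) + 1)) * h1
    - ((n : ℝ) + 1) * (n + 1) * n.choose j * h2 - (n.choose j) * ((n : ℝ) + 1) * (n + j + 2) * h3

/-- a uniform parametrisation of the neighbours of `lam (n+1) (j+1)` -/
lemma lam_param (n j : ℕ) : ∃ w : ℝ,
    lam (n + 2) (j + 1) = w * ((n : ℝ) + j + 2) * ((n : ℝ) + j + 3) ∧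
    lam (n + 1) (j + 1) = w * ((n : ℝ) + j + 2) * ((n : ℝ) + 1 - j) ∧
    lam n (j + 1) = w * ((n : ℝ) + 1 - j) * ((n : ℝ) - j) ∧
    lam (n + 1) j = w * ((j : ℝ) + 1) ^ 2 := by
  have p2 : ((n : ℝ) + j + 2) ≠ 0 := by positivity
  have p3 : ((n : ℝ) + j + 3) ≠ 0 := by positivity
  have e1 := lam_L1 (n + 1) (j + 1)
  have e2 := lam_L1 n (j + 1)
  have e3 := lam_L3 (n + 1) j
  push_cast at e1 e2 e3
  rw [show n + 1 + 1 = n + 2 by omega] at e1 e3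
  obtain ⟨w, hw⟩ : ∃ w, lam (n + 2) (j + 1) = w * ((n : ℝ) + j + 2) * ((n : ℝ) + j + 3) :=
    ⟨lam (n + 2) (j + 1) / (((n : ℝ) + j + 2) * ((n : ℝ) + j + 3)), by field_simp⟩
  have h1 : lam (n + 1) (j + 1) = w * ((n : ℝ) + j + 2) * ((n : ℝ) + 1 - j) := by
    apply mul_right_cancel₀ p3
    rw [hw] at e1
    linear_combination -e1
  refine ⟨w, hw, h1, ?_, ?_⟩
  · apply mul_right_cancel₀ p2
    rw [h1] at e2
    linear_combination -e2
  · apply mul_right_cancel₀ (mul_ne_zero p2 p3)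
    rw [hw] at e3
    linear_combination -e3

noncomputable def BB (n k : ℕ) : ℝ :=
  4 * (2 * (n : ℝ) + 3) * ((k : ℝ) * (2 * k + 1) - (2 * n + 3) ^ 2) * lam (n + 1) k ^ 2

/-- `P(n+1)` -/
noncomputable def PP (n : ℕ) : ℝ :=
  34 * ((n : ℝ) + 1) ^ 3 + 51 * ((n : ℝ) + 1) ^ 2 + 27 * ((n : ℝ) + 1) + 5

lemma BB_zero (n : ℕ) : ((n : ℝ) + 2) ^ 3 * lam (n + 2) 0 ^ 2 - PP n * lam (n + 1) 0 ^ 2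
    + ((n : ℝ) + 1) ^ 3 * lam n 0 ^ 2 = BB n 0 := by
  simp only [BB, PP, lam_zero]; push_cast; ring

lemma BB_succ (n j : ℕ) : ((n : ℝ) + 2) ^ 3 * lam (n + 2) (j + 1) ^ 2
    - PP n * lam (n + 1) (j + 1) ^ 2
    + ((n : ℝ) + 1) ^ 3 * lam n (j + 1) ^ 2 = BB n (j + 1) - BB n j := by
  obtain ⟨w, h1, h2, h3, h4⟩ := lam_param n j
  simp only [BB, PP, h1, h2, h3, h4]; push_cast; ring

lemma bb_ext (n N : ℕ) (h : n + 1 ≤ N) : bb n = ∑ k ∈ Finset.range N, lam n k ^ 2 := by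
  unfold bb
  apply Finset.sum_subset
  · intro x; simp only [Finset.mem_range]; omega
  · intro x _ hx
    rw [Finset.mem_range] at hx
    rw [lam_eq_zero (by omega)]; simp

lemma aa_ext (n N : ℕ) (h : n + 1 ≤ N) : aa n = ∑ k ∈ Finset.range N, lam n k ^ 2 * cc n k := by
  unfold aa
  apply Finset.sum_subset
  · intro x; simp only [Finset.mem_range]; omega
  · intro x _ hx
    rw [Finset.mem_range] at hx
    rw [lam_eq_zero (by omega)]; simp

lemma bb_rec (n : ℕ) : ((n : ℝ) + 2) ^ 3 * bb (n + 2) - PP n * bb (n + 1)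
    + ((n : ℝ) + 1) ^ 3 * bb n = 0 := by
  rw [bb_ext (n + 2) (n + 3) (by omega), bb_ext (n + 1) (n + 3) (by omega),
    bb_ext n (n + 3) (by omega), Finset.mul_sum, Finset.mul_sum, Finset.mul_sum,
    ← Finset.sum_sub_distrib, ← Finset.sum_add_distrib]
  have key : ∀ K : ℕ, ∑ k ∈ Finset.range (K + 1), (((n : ℝ) + 2) ^ 3 * lam (n + 2) k ^ 2
    - PP n * lam (n + 1) k ^ 2 + ((n : ℝ) + 1) ^ 3 * lam n k ^ 2) = BB n K := by
    intro K
    induction K with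
    | zero => rw [Finset.sum_range_one, BB_zero]
    | succ K ih => rw [Finset.sum_range_succ, ih, BB_succ]; ring
  rw [key (n + 2)]
  simp [BB, lam_eq_zero]

lemma cc_diff (n k : ℕ) (h : k ≤ n) :
    cc (n + 1) k - cc n k = (-1) ^ k / (((n : ℝ) + 1) ^ 2 * ((n : ℝ) + 1 + k) * lam n k) := by
  induction k with
  | zero =>
    simp only [cc, Finset.sum_range_succ, Finset.sum_range_zero, lam_zero]
    push_cast
    field_simp
    ring
  | succ k ih =>
    have ih := ih (by omega)
    have s1 : cc (n + 1) (k + 1) = cc (n + 1) k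
      + (-1 : ℝ) ^ k / (2 * ((k : ℝ) + 1) ^ 3 * lam (n + 1) (k + 1)) := by
      simp only [cc, Finset.sum_range_succ]; ring
    have s2 : cc n (k + 1) = cc n k
      + (-1 : ℝ) ^ k / (2 * ((k : ℝ) + 1) ^ 3 * lam n (k + 1)) := by
      simp only [cc, Finset.sum_range_succ]; ring
    have e3 := lam_L3 n k
    have e1 := lam_L1 n (k + 1)
    have q0 : 0 < lam n k := lam_pos (by omega)
    obtain ⟨d, rfl⟩ := Nat.exists_eq_add_of_le h
    push_cast at *
    have d1 : ((k : ℝ) + 1 + d + 1 - (k + 1)) = d + 1 := by ring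
    rw [d1] at e1
    set v := lam (k + 1 + d) k with hv
    have f1 : lam (k + 1 + d + 1) (k + 1)
        = v * ((k : ℝ) + 1 + d + k + 2) * ((k : ℝ) + 1 + d + k + 1) / ((k : ℝ) + 1) ^ 2 := by
      field_simp; linarith
    have f2 : lam (k + 1 + d) (k + 1)
        = v * ((k : ℝ) + 1 + d + k + 1) * (d + 1) / ((k : ℝ) + 1) ^ 2 := by
      rw [f1] at e1
      have : ((k : ℝ) + 1 + d + 1 + (k + 1)) ≠ 0 := by positivity
      apply mul_right_cancel₀ this
      rw [← e1]; field_simp; ring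
    rw [s1, s2, f1, f2]
    have : cc (k + 1 + d + 1) k = cc (k + 1 + d) k + (-1) ^ k / (((k:ℝ) + 1 + d + 1) ^ 2 * ((k:ℝ) + 1 + d + 1 + k) * v) := by
      linarith
    rw [this, pow_succ]
    have t1 : ((k:ℝ) + 1 + d + 1) ≠ 0 := by positivity
    have t2 : ((k:ℝ) + 1 + d + 1 + k) ≠ 0 := by positivity
    have t3 : ((k:ℝ) + 1 + d + k + 1) ≠ 0 := by positivity
    have t4 : ((k:ℝ) + 1 + d + k + 2) ≠ 0 := by positivity
    have t5 : ((k:ℝ) + 1 + d + 1 + (k + 1)) ≠ 0 := by positivity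
    have t6 : (d:ℝ) + 1 ≠ 0 := by positivity
    field_simp
    ring

end Apery

namespace Apery

noncomputable def AA (n k : ℕ) : ℝ :=
  BB n k * cc (n + 1) k
    - 5 * (2 * (n : ℝ) + 3) * (-1) ^ k * k / (((n : ℝ) + 1) * (n + 2)) * lam (n + 1) k

lemma cc_succ (n k : ℕ) : cc n (k + 1) = cc n k
      + (-1 : ℝ) ^ k / (2 * ((k : ℝ) + 1) ^ 3 * lam n (k + 1)) := by
  simp only [cc, Finset.sum_range_succ]; ring

/-- summand of the recurrence for `aa` -/
noncomputable def FF (n k : ℕ) : ℝ :=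
  ((n : ℝ) + 2) ^ 3 * (lam (n + 2) k ^ 2 * cc (n + 2) k)
    - PP n * (lam (n + 1) k ^ 2 * cc (n + 1) k)
    + ((n : ℝ) + 1) ^ 3 * (lam n k ^ 2 * cc n k)

lemma lam_cc_low (n k : ℕ) : lam n k ^ 2 * cc n k = lam n k ^ 2 * cc (n + 1) k
    - (-1) ^ k * lam n k / (((n : ℝ) + 1) ^ 2 * ((n : ℝ) + 1 + k)) := by
  rcases Nat.lt_or_ge n k with h | h
  · rw [lam_eq_zero h]; simp
  · have h1 := cc_diff n k h
    have h2 := lam_pos h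
    have : cc (n + 1) k
      = cc n k + (-1) ^ k / (((n : ℝ) + 1) ^ 2 * ((n : ℝ) + 1 + k) * lam n k) := by linarith
    rw [this]
    field_simp
    ring

lemma FF_zero (n : ℕ) : FF n 0 = AA n 0 := by
  unfold FF AA
  rw [lam_cc_low n 0]
  have h1 := cc_diff (n + 1) 0 (by omega)
  have h2 : cc (n + 2) 0 = cc (n + 1) 0 + 1 / ((n : ℝ) + 2) ^ 3 := by
    rw [lam_zero] at h1
    push_cast at h1
    rw [show (n : ℝ) + 2 = n + 1 + 1 by ring]
    have : (1 : ℝ) / ((n : ℝ) + 1 + 1) ^ 3 = (-1) ^ 0 / (((n : ℝ) + 1 + 1) ^ 2 * ((n : ℝ) + 1 + 1 + 0) * 1) := by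
      field_simp; ring
    rw [this, ← h1]; ring
  rw [h2]
  simp only [lam_zero, BB, PP]
  push_cast
  field_simp
  ring

lemma FF_succ (n j : ℕ) (h : j ≤ n) : FF n (j + 1) = AA n (j + 1) - AA n j := by
  unfold FF AA
  rw [lam_cc_low n (j + 1)]
  have h1 := cc_diff (n + 1) (j + 1) (by omega)
  have h2 : cc (n + 2) (j + 1) = cc (n + 1) (j + 1)
    + (-1) ^ (j + 1) / (((n : ℝ) + 2) ^ 2 * ((n : ℝ) + j + 3) * lam (n + 1) (j + 1)) := by
    push_cast at h1
    rw [show ((n : ℝ) + 1 + 1) = n + 2 by ring, show (n : ℝ) + 2 + (j + 1) = n + j + 3 by ring] at h1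
    rw [← h1]; ring
  have hB := BB_succ n j
  have h3 := cc_succ (n + 1) j
  have h4 : cc (n + 1) j = cc (n + 1) (j + 1)
    - (-1 : ℝ) ^ j / (2 * ((j : ℝ) + 1) ^ 3 * lam (n + 1) (j + 1)) := by linarith
  rw [h2, h4]
  have hB' : BB n (j + 1) = ((n : ℝ) + 2) ^ 3 * lam (n + 2) (j + 1) ^ 2
    - PP n * lam (n + 1) (j + 1) ^ 2
    + ((n : ℝ) + 1) ^ 3 * lam n (j + 1) ^ 2 + BB n j := by linarith
  rw [hB']
  have hpos : 0 < lam (n + 1) (j + 1) := lam_pos (by omega)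
  obtain ⟨w, e1, e2, e3, e4⟩ := lam_param n j
  have hw : w ≠ 0 := by
    rintro rfl
    simp at e2
    linarith
  generalize cc (n + 1) (j + 1) = c
  have hBj : BB n j = 4 * (2 * (n : ℝ) + 3) * ((j : ℝ) * (2 * j + 1) - (2 * n + 3) ^ 2)
    * (w * ((j : ℝ) + 1) ^ 2) ^ 2 := by rw [BB, e4]
  rw [hBj, e1, e2, e3, e4]
  obtain ⟨d, rfl⟩ := Nat.exists_eq_add_of_le h
  push_cast
  rw [show ((j : ℝ) + d + 1 - j) = d + 1 by ring, show ((j : ℝ) + d - j) = d by ring, pow_succ (-1 : ℝ) j]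
  have t1 : ((d:ℝ) + 1) ≠ 0 := by positivity
  have t2 : ((j:ℝ) + d + 1) ≠ 0 := by positivity
  have t3 : ((j:ℝ) + d + 2) ≠ 0 := by positivity
  have t4 : ((j:ℝ) + d + j + 2) ≠ 0 := by positivity
  have t5 : ((j:ℝ) + d + j + 3) ≠ 0 := by positivity
  have t6 : ((j:ℝ) + d + 1 + (j + 1)) ≠ 0 := by positivity
  field_simp
  ring

lemma FF_last (n : ℕ) : FF n (n + 2) = - AA n (n + 1) := by
  have hB := BB_succ n (n + 1)
  have z1 : lam (n + 1) (n + 2) = 0 := lam_eq_zero (by omega)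
  have z2 : lam n (n + 2) = 0 := lam_eq_zero (by omega)
  have zB : BB n (n + 2) = 0 := by simp [BB, z1]
  rw [show n + 1 + 1 = n + 2 by omega, z1, z2, zB] at hB
  have h1 := cc_diff (n + 1) (n + 1) le_rfl
  have h2 := cc_succ (n + 2) (n + 1)
  have e3 := lam_L3 (n + 1) (n + 1)
  rw [show n + 1 + 1 = n + 2 by omega] at h1 h2 e3
  have p : 0 < lam (n + 1) (n + 1) := lam_pos le_rfl
  unfold FF AA
  rw [z1, z2]
  have hB' : BB n (n + 1) = - (((n : ℝ) + 2) ^ 3 * lam (n + 2) (n + 2) ^ 2) := by linarith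
  push_cast at *
  have h1' : cc (n + 2) (n + 1) = cc (n + 1) (n + 1) + (-1) ^ (n + 1)
    / (((n : ℝ) + 1 + 1) ^ 2 * ((n : ℝ) + 1 + 1 + (n + 1)) * lam (n + 1) (n + 1)) := by linarith
  have e3' : lam (n + 2) (n + 2) = lam (n + 1) (n + 1) * ((n : ℝ) + 1 + (n + 1) + 2)
    * ((n : ℝ) + 1 + (n + 1) + 1) / ((n : ℝ) + 1 + 1) ^ 2 := by
    field_simp; linarith
  rw [hB', h2, h1', e3']
  generalize cc (n + 1) (n + 1) = c
  field_simp
  ring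

lemma aa_rec (n : ℕ) : ((n : ℝ) + 2) ^ 3 * aa (n + 2) - PP n * aa (n + 1)
    + ((n : ℝ) + 1) ^ 3 * aa n = 0 := by
  rw [aa_ext (n + 2) (n + 3) (by omega), aa_ext (n + 1) (n + 3) (by omega),
    aa_ext n (n + 3) (by omega), Finset.mul_sum, Finset.mul_sum, Finset.mul_sum,
    ← Finset.sum_sub_distrib, ← Finset.sum_add_distrib]
  change ∑ k ∈ Finset.range (n + 2 + 1), FF n k = 0
  have key : ∀ K : ℕ, K ≤ n + 1 → ∑ k ∈ Finset.range (K + 1), FF n k = AA n K := by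
    intro K
    induction K with
    | zero => intro _; rw [Finset.sum_range_one, FF_zero]
    | succ K ih => intro h; rw [Finset.sum_range_succ, ih (by omega), FF_succ n K (by omega)]; ring
  rw [Finset.sum_range_succ, key (n + 1) le_rfl, FF_last]
  ring

lemma casoratian (n : ℕ) : aa (n + 1) * bb n - aa n * bb (n + 1) = 6 / ((n : ℝ) + 1) ^ 3 := by
  induction n with
  | zero =>
    simp [aa, bb, cc, lam, Finset.sum_range_succ]
    norm_num
  | succ n ih =>
    have h1 := aa_rec n
    have h2 := bb_rec n
    have p1 : ((n : ℝ) + 1) ≠ 0 := by positivity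
    have p2 : ((n : ℝ) + 2) ≠ 0 := by positivity
    push_cast
    rw [show (n : ℝ) + 1 + 1 = n + 2 by ring, show n + 1 + 1 = n + 2 by omega]
    rw [eq_div_iff (pow_ne_zero 3 p1)] at ih
    rw [eq_div_iff (pow_ne_zero 3 p2)]
    linear_combination ih + bb (n + 1) * h1 - aa (n + 1) * h2

lemma lam_mono (n k : ℕ) : lam n k ≤ lam (n + 1) k := by
  unfold lam
  have h1 : n.choose k ≤ (n + 1).choose k := Nat.choose_le_choose k (by omega)
  have h2 : (n + k).choose k ≤ (n + 1 + k).choose k := Nat.choose_le_choose k (by omega)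
  gcongr

lemma bb_mono (n : ℕ) : bb n ≤ bb (n + 1) := by
  rw [bb_ext n (n + 2) (by omega)]
  exact Finset.sum_le_sum fun k _ => pow_le_pow_left₀ (lam_nonneg _ _) (lam_mono n k) 2

lemma bb_pos (n : ℕ) : 0 < bb n :=
  Finset.sum_pos (fun k hk => pow_pos (lam_pos (by rw [Finset.mem_range] at hk; omega)) 2) (by simp)

lemma bb_growth (n : ℕ) (hn : 1000 ≤ n) : 329 / 10 * bb (n + 1) ≤ bb (n + 2) := by
  have h := bb_rec n
  have hm := bb_mono n
  have hp := bb_pos (n + 1)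
  have hx : (1000 : ℝ) ≤ n := by exact_mod_cast hn
  have p2 : 0 < ((n : ℝ) + 2) ^ 3 := by positivity
  have k1 : ((n : ℝ) + 1) ^ 3 * bb n ≤ ((n : ℝ) + 1) ^ 3 * bb (n + 1) := by gcongr
  have k2 : 329 / 10 * ((n : ℝ) + 2) ^ 3 ≤ PP n - ((n : ℝ) + 1) ^ 3 := by
    obtain ⟨t, ht, hnt⟩ : ∃ t : ℝ, 0 ≤ t ∧ (n : ℝ) = t + 1000 := ⟨n - 1000, by linarith, by ring⟩
    unfold PP
    rw [hnt]
    nlinarith [pow_nonneg ht 3, pow_nonneg ht 2]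
  have k3 := mul_le_mul_of_nonneg_right k2 hp.le
  refine le_of_mul_le_mul_left ?_ p2
  linarith

end Apery

namespace Apery

lemma choose_mul_pow_le (a b x y : ℕ) : (a + b).choose a * (x ^ a * y ^ b) ≤ (x + y) ^ (a + b) := by
  rw [add_pow]
  have h := Finset.single_le_sum (s := Finset.range (a + b + 1))
    (f := fun m => x ^ m * y ^ (a + b - m) * (a + b).choose m)
    (fun i _ => Nat.zero_le _) (Finset.mem_range.2 (by omega : a < a + b + 1))
  simp only [Nat.add_sub_cancel_left] at h
  calc _ = x ^ a * y ^ b * (a + b).choose a := by ring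
    _ ≤ _ := h

def MM (m : ℕ) : ℕ := (21 * m + 21 * m).choose (21 * m) * (14 * m + 7 * m).choose (14 * m)
  * (6 * m + m).choose (6 * m)

lemma MM_spec (m : ℕ) : (42 * m).factorial =
    MM m * ((21 * m).factorial * (14 * m).factorial * (6 * m).factorial * m.factorial) := by
  have h1 := Nat.add_choose_mul_factorial_mul_factorial (21 * m) (21 * m)
  have h2 := Nat.add_choose_mul_factorial_mul_factorial (7 * m) (14 * m)
  have h3 := Nat.add_choose_mul_factorial_mul_factorial m (6 * m)
  rw [show 21 * m + 21 * m = 42 * m by ring] at h1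
  rw [show 7 * m + 14 * m = 21 * m by ring] at h2
  rw [show m + 6 * m = 7 * m by ring] at h3
  rw [MM, show 21 * m + 21 * m = 42 * m by ring, show 14 * m + 7 * m = 21 * m by ring,
    show 6 * m + m = 7 * m by ring, ← h1]
  conv_lhs => rw [mul_assoc]; arg 2; arg 2; rw [← h2, ← h3]
  ring

lemma MM_pos (m : ℕ) : MM m ≠ 0 := by
  unfold MM
  have h1 : 0 < (21 * m + 21 * m).choose (21 * m) := Nat.choose_pos (by omega)
  have h2 : 0 < (14 * m + 7 * m).choose (14 * m) := Nat.choose_pos (by omega)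
  have h3 : 0 < (6 * m + m).choose (6 * m) := Nat.choose_pos (by omega)
  positivity

lemma MM_le (m : ℕ) : MM m ≤ (2 ^ 22 * 3 ^ 15 * 7 ^ 7) ^ m := by
  have h1 := choose_mul_pow_le (21 * m) (21 * m) 1 1
  have h2 := choose_mul_pow_le (14 * m) (7 * m) 2 1
  have h3 := choose_mul_pow_le (6 * m) m 6 1
  simp only [one_pow, mul_one] at h1 h2 h3
  have hp : 0 < 2 ^ (14 * m) * 6 ^ (6 * m) := by positivity
  refine Nat.le_of_mul_le_mul_right ?_ hp
  calc MM m * (2 ^ (14 * m) * 6 ^ (6 * m))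
      = (21 * m + 21 * m).choose (21 * m) * ((14 * m + 7 * m).choose (14 * m) * 2 ^ (14 * m))
        * ((6 * m + m).choose (6 * m) * 6 ^ (6 * m)) := by unfold MM; ring
    _ ≤ (1 + 1) ^ (21 * m + 21 * m) * (2 + 1) ^ (14 * m + 7 * m) * (6 + 1) ^ (6 * m + m) := by
        gcongr
    _ = (2 ^ 22 * 3 ^ 15 * 7 ^ 7) ^ m * (2 ^ (14 * m) * 6 ^ (6 * m)) := by
        rw [show 21 * m + 21 * m = 42 * m by ring, show 14 * m + 7 * m = 21 * m by ring,
          show 6 * m + m = 7 * m by ring]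
        simp only [pow_mul, ← mul_pow]
        norm_num

lemma div_ineq (m q : ℕ) (hq : 0 < q) :
    21 * m / q + 14 * m / q + 6 * m / q + m / q + (if m < q ∧ q ≤ 42 * m then 1 else 0)
      ≤ 42 * m / q := by
  have a1 := Nat.div_mul_le_self (21 * m) q
  have a2 := Nat.div_mul_le_self (14 * m) q
  have a3 := Nat.div_mul_le_self (6 * m) q
  have a4 := Nat.div_mul_le_self m q
  rw [Nat.le_div_iff_mul_le hq]
  split_ifs with h
  · have a4 : m / q = 0 := Nat.div_eq_of_lt h.1
    rw [a4]
    by_contra hc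
    push Not at hc
    generalize 21 * m / q = u at *
    generalize 14 * m / q = v at *
    generalize 6 * m / q = w at *
    have h5 : (u + v + w + 1) * q ≤ 41 * m + q := by nlinarith
    -- multiples of q: 42 m < (u+v+w+1) q
    have hu : u * 2 * q ≤ 42 * m := by linarith
    have hv : v * 3 * q ≤ 42 * m := by linarith
    have hw : w * 7 * q ≤ 42 * m := by linarith
    have hlt : 42 * m < (u + v + w + 1) * q := by linarith
    have c1 : u * 2 < u + v + w + 1 := lt_of_mul_lt_mul_right (lt_of_le_of_lt hu hlt) (Nat.zero_le q)
    have c2 : v * 3 < u + v + w + 1 := lt_of_mul_lt_mul_right (lt_of_le_of_lt hv hlt) (Nat.zero_le q)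
    have c3 : w * 7 < u + v + w + 1 := lt_of_mul_lt_mul_right (lt_of_le_of_lt hw hlt) (Nat.zero_le q)
    have c4 : 41 ≤ u + v + w := by
      by_contra hh
      push Not at hh
      have : u + v + w = 0 := by omega
      have hu0 : u = 0 := by omega
      have hv0 : v = 0 := by omega
      have hw0 : w = 0 := by omega
      subst hu0 hv0 hw0
      linarith [h.2]
    have : 41 * q ≤ (u + v + w) * q := Nat.mul_le_mul_right q c4
    nlinarith [h.1]
  · nlinarith

lemma lcm_dvd (m : ℕ) (hm : 0 < m) : Nat.lcmUpto (42 * m) ∣ Nat.lcmUpto m * MM m := by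
  rw [← Nat.factorization_le_iff_dvd (Nat.lcmUpto_ne_zero _)
    (mul_ne_zero (Nat.lcmUpto_ne_zero _) (MM_pos m))]
  intro p
  by_cases hp : p.Prime
  swap
  · simp [Nat.factorization_eq_zero_of_not_prime _ hp]
  rw [Nat.factorization_mul (Nat.lcmUpto_ne_zero _) (MM_pos m), Finsupp.add_apply,
    Nat.factorization_lcmUpto _ hp, Nat.factorization_lcmUpto _ hp]
  have hs := congrArg (fun x => x.factorization p) (MM_spec m)
  have f0 := fun k => Nat.factorial_ne_zero k
  rw [Nat.factorization_mul (MM_pos m) (by simp [f0]),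
    Nat.factorization_mul (by simp [f0]) (by simp [f0]),
    Nat.factorization_mul (by simp [f0]) (by simp [f0]),
    Nat.factorization_mul (by simp [f0]) (by simp [f0])] at hs
  simp only [Finsupp.add_apply] at hs
  set b := p.log (42 * m) + 1 with hb
  have lg : ∀ k, k ≤ 42 * m → p.log k < b := fun k hk => by
    have := Nat.log_mono_right (b := p) hk
    omega
  rw [Nat.factorization_factorial hp (lg (42 * m) le_rfl),
    Nat.factorization_factorial hp (lg (21 * m) (by omega)),
    Nat.factorization_factorial hp (lg (14 * m) (by omega)),
    Nat.factorization_factorial hp (lg (6 * m) (by omega)),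
    Nat.factorization_factorial hp (lg m (by omega))] at hs
  have hsum : ∑ i ∈ Finset.Ico 1 b, (21 * m / p ^ i + 14 * m / p ^ i + 6 * m / p ^ i + m / p ^ i
      + (if m < p ^ i ∧ p ^ i ≤ 42 * m then 1 else 0)) ≤ ∑ i ∈ Finset.Ico 1 b, 42 * m / p ^ i :=
    Finset.sum_le_sum fun i _ => div_ineq m (p ^ i) (pow_pos hp.pos i)
  simp only [Finset.sum_add_distrib] at hsum
  have hcard : p.log (42 * m) - p.log m ≤
      ∑ i ∈ Finset.Ico 1 b, (if m < p ^ i ∧ p ^ i ≤ 42 * m then 1 else 0) := by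
    calc p.log (42 * m) - p.log m = ∑ i ∈ Finset.Ico (p.log m + 1) b, 1 := by
          simp [hb]
      _ = ∑ i ∈ Finset.Ico (p.log m + 1) b, (if m < p ^ i ∧ p ^ i ≤ 42 * m then 1 else 0) := by
          apply Finset.sum_congr rfl
          intro i hi
          rw [Finset.mem_Ico] at hi
          rw [if_pos]
          exact ⟨Nat.lt_pow_of_log_lt hp.one_lt (by omega),
            Nat.pow_le_of_le_log (by omega) (by omega)⟩
      _ ≤ _ := by
          apply Finset.sum_le_sum_of_subset
          apply Finset.Ico_subset_Ico_left
          omega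
  omega

lemma lcm_mono {a b : ℕ} (h : a ≤ b) : Nat.lcmUpto a ∣ Nat.lcmUpto b := by
  unfold Nat.lcmUpto
  exact Finset.lcm_mono (Finset.Icc_subset_Icc_right h)

lemma lcm_le_mono {a b : ℕ} (h : a ≤ b) : Nat.lcmUpto a ≤ Nat.lcmUpto b :=
  Nat.le_of_dvd (Nat.lcmUpto_pos b) (lcm_mono h)

lemma lcm_bound : ∃ C : ℝ, 0 < C ∧ ∀ n : ℕ, (Nat.lcmUpto n : ℝ) ≤ C * (16 / 5 : ℝ) ^ n := by
  refine ⟨Nat.lcmUpto 882, by exact_mod_cast Nat.lcmUpto_pos _, ?_⟩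
  intro n
  induction n using Nat.strong_induction_on with
  | _ n ih =>
    rcases Nat.lt_or_ge n 882 with h | h
    · have h1 : (Nat.lcmUpto n : ℝ) ≤ Nat.lcmUpto 882 := by
        exact_mod_cast lcm_le_mono (by omega)
      have h2 : (1 : ℝ) ≤ (16 / 5 : ℝ) ^ n := one_le_pow₀ (by norm_num)
      nlinarith [show (0 : ℝ) ≤ Nat.lcmUpto 882 from Nat.cast_nonneg _]
    · obtain ⟨m, hm1, hm2, hm3⟩ : ∃ m, n ≤ 42 * m ∧ 42 * m ≤ n + 41 ∧ 21 ≤ m :=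
        ⟨(n + 41) / 42, by omega, by omega, by omega⟩
      have i1 := ih m (by omega)
      have i2 : Nat.lcmUpto n ≤ Nat.lcmUpto m * (2 ^ 22 * 3 ^ 15 * 7 ^ 7) ^ m :=
        (lcm_le_mono hm1).trans <| (Nat.le_of_dvd
          (Nat.mul_pos (Nat.lcmUpto_pos m) (Nat.pos_of_ne_zero (MM_pos m)))
          (lcm_dvd m (by omega))).trans <| Nat.mul_le_mul_left _ (MM_le m)
      have i3 : (Nat.lcmUpto n : ℝ) ≤ Nat.lcmUpto m * (2 ^ 22 * 3 ^ 15 * 7 ^ 7) ^ m := by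
        exact_mod_cast i2
      set C : ℝ := (Nat.lcmUpto 882 : ℝ)
      have hC : 0 ≤ C := Nat.cast_nonneg _
      have k1 : (16 / 5 : ℝ) * (2 ^ 22 * 3 ^ 15 * 7 ^ 7) ≤ (16 / 5) ^ 42 / 10 := by norm_num
      have k2 : (16 / 5 : ℝ) ^ 41 ≤ 10 ^ m := by
        calc (16 / 5 : ℝ) ^ 41 ≤ 10 ^ 21 := by norm_num
          _ ≤ 10 ^ m := pow_le_pow_right₀ (by norm_num) hm3
      have k3 : ((16 / 5 : ℝ) ^ 42) ^ m ≤ (16 / 5) ^ n * (16 / 5) ^ 41 := by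
        rw [← pow_mul, ← pow_add]
        exact pow_le_pow_right₀ (by norm_num) hm2
      calc (Nat.lcmUpto n : ℝ) ≤ C * (16 / 5) ^ m * (2 ^ 22 * 3 ^ 15 * 7 ^ 7) ^ m :=
            i3.trans (mul_le_mul_of_nonneg_right i1 (by positivity))
        _ = C * ((16 / 5) * (2 ^ 22 * 3 ^ 15 * 7 ^ 7)) ^ m := by rw [mul_assoc, ← mul_pow]
        _ ≤ C * ((16 / 5) ^ 42 / 10) ^ m := by
            apply mul_le_mul_of_nonneg_left _ hC
            exact pow_le_pow_left₀ (by positivity) k1 m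
        _ = C * (((16 / 5) ^ 42) ^ m / 10 ^ m) := by rw [div_pow]
        _ ≤ C * (16 / 5) ^ n := by
            apply mul_le_mul_of_nonneg_left _ hC
            rw [div_le_iff₀ (by positivity)]
            exact k3.trans (mul_le_mul_of_nonneg_left k2 (by positivity))

/-- Leibniz triangle divisibility -/
lemma leibniz_int (D : ℕ) (n : ℕ) (hD : ∀ i, 1 ≤ i → i ≤ n → i ∣ D) (m : ℕ) :
    ∀ k, m + 1 ≤ k → k ≤ n →
      ∃ z : ℤ, (D : ℝ) / (((m : ℝ) + 1) * (k.choose (m + 1) : ℝ)) = z := by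
  induction m with
  | zero =>
    intro k hk hkn
    obtain ⟨c, hc⟩ := hD k hk hkn
    refine ⟨c, ?_⟩
    have : (k : ℝ) ≠ 0 := by positivity
    simp [hc]
    field_simp
  | succ m ih =>
    intro k hk hkn
    obtain ⟨k, rfl⟩ : ∃ k', k = k' + 1 := ⟨k - 1, by omega⟩
    obtain ⟨z1, h1⟩ := ih k (by omega) (by omega)
    obtain ⟨z2, h2⟩ := ih (k + 1) (by omega) (by omega)
    refine ⟨z1 - z2, ?_⟩
    push_cast
    rw [← h1, ← h2]
    have p1 : 0 < k.choose (m + 1) := Nat.choose_pos (by omega)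
    have p2 : 0 < (k + 1).choose (m + 1) := Nat.choose_pos (by omega)
    have p3 : 0 < (k + 1).choose (m + 1 + 1) := Nat.choose_pos (by omega)
    have e1 : ((k : ℝ) + 1) * (k.choose (m + 1) : ℝ)
        = ((k + 1).choose (m + 1 + 1) : ℝ) * ((m : ℝ) + 2) := by
      have := Nat.add_one_mul_choose_eq k (m + 1)
      have h' : (((k + 1) * k.choose (m + 1) : ℕ) : ℝ)
        = (((k + 1).choose (m + 1 + 1) * (m + 1 + 1) : ℕ) : ℝ) := by rw [this]
      push_cast at h'
      linarith
    have e2 : (k.choose (m + 1) : ℝ) * ((k : ℝ) + 1)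
        = ((k + 1).choose (m + 1) : ℝ) * ((k : ℝ) - m) := by
      have := Nat.choose_mul_succ_eq k (m + 1)
      have h' : ((k.choose (m + 1) * (k + 1) : ℕ) : ℝ)
        = (((k + 1).choose (m + 1) * (k + 1 - (m + 1)) : ℕ) : ℝ) := by rw [this]
      rw [Nat.cast_mul, Nat.cast_mul, Nat.cast_sub (by omega)] at h'
      push_cast at h'
      linarith
    have hkm : (0 : ℝ) < (k : ℝ) - m := by
      have : (m : ℝ) + 1 ≤ k := by exact_mod_cast (by omega : m + 1 ≤ k)
      linarith
    have q1 : (0 : ℝ) < k.choose (m + 1) := by exact_mod_cast p1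
    have r3 : ((k + 1).choose (m + 1 + 1) : ℝ) = ((k : ℝ) + 1) * k.choose (m + 1) / ((m : ℝ) + 2) := by
      field_simp; linarith
    have r2 : ((k + 1).choose (m + 1) : ℝ) = ((k : ℝ) + 1) * k.choose (m + 1) / ((k : ℝ) - m) := by
      field_simp; linarith
    rw [r3, r2]
    have : (m : ℝ) + 1 + 1 ≠ 0 := by positivity
    field_simp
    ring

end Apery

namespace Apery

noncomputable def zz : ℝ := ∑' k : ℕ, 1 / ((k : ℝ) + 1) ^ 3

lemma zz_summable : Summable (fun k : ℕ => 1 / ((k : ℝ) + 1) ^ 3) := by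
  have h := (Real.summable_one_div_nat_pow (p := 3)).2 (by norm_num)
  have h2 := (summable_nat_add_iff 1).2 h
  simpa using h2

lemma lam_ge (n m : ℕ) (h : m + 1 ≤ n) : (n : ℝ) + 1 ≤ lam n (m + 1) := by
  unfold lam
  have h1 : 1 ≤ n.choose (m + 1) := Nat.choose_pos h
  have h2 : n + 1 ≤ (n + (m + 1)).choose (m + 1) := by
    rw [Nat.choose_symm_add.symm]
    calc n + 1 = (n + 1).choose n := by simp
      _ ≤ _ := Nat.choose_le_choose n (by omega)
  have := Nat.mul_le_mul h1 h2
  rw [one_mul] at this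
  exact_mod_cast this

lemma cc_close (n k : ℕ) (h : k ≤ n) : |cc n k - zz| ≤
    (zz - ∑ m ∈ Finset.range n, 1 / ((m : ℝ) + 1) ^ 3) + zz / ((n : ℝ) + 1) := by
  have hS : ∀ k, ∑ m ∈ Finset.range k, 1 / ((m : ℝ) + 1) ^ 3 ≤ zz := fun k =>
    zz_summable.sum_le_tsum _ (fun i _ => by positivity)
  have h2 : |∑ m ∈ Finset.range k, (-1 : ℝ) ^ m / (2 * ((m : ℝ) + 1) ^ 3 * lam n (m + 1))|
      ≤ zz / ((n : ℝ) + 1) := by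
    calc _ ≤ ∑ m ∈ Finset.range k, |(-1 : ℝ) ^ m / (2 * ((m : ℝ) + 1) ^ 3 * lam n (m + 1))| :=
          Finset.abs_sum_le_sum_abs _ _
      _ ≤ ∑ m ∈ Finset.range k, 1 / ((m : ℝ) + 1) ^ 3 * (1 / ((n : ℝ) + 1)) := by
          apply Finset.sum_le_sum
          intro m hm
          rw [Finset.mem_range] at hm
          have hl := lam_ge n m (by omega)
          have hl0 : 0 < lam n (m + 1) := lam_pos (by omega)
          rw [abs_div, abs_pow, abs_neg, abs_one, one_pow, abs_of_pos (by positivity),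
            one_div_mul_one_div]
          apply one_div_le_one_div_of_le (by positivity)
          have q : (0 : ℝ) < ((m : ℝ) + 1) ^ 3 := by positivity
          nlinarith [mul_pos q hl0, mul_le_mul_of_nonneg_left hl q.le]
      _ = (∑ m ∈ Finset.range k, 1 / ((m : ℝ) + 1) ^ 3) / ((n : ℝ) + 1) := by
          rw [← Finset.sum_mul]; ring
      _ ≤ _ := by
          have := hS k
          gcongr
  have e : cc n k - zz = (∑ m ∈ Finset.range k, (-1 : ℝ) ^ m / (2 * ((m : ℝ) + 1) ^ 3 * lam n (m + 1)))
      - (zz - ∑ m ∈ Finset.range n, 1 / ((m : ℝ) + 1) ^ 3) := by unfold cc; ring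
  rw [e]
  refine (abs_sub _ _).trans ?_
  rw [abs_of_nonneg (sub_nonneg.2 (hS n))]
  linarith

lemma tendsto_ratio : Filter.Tendsto (fun n => aa n / bb n) Filter.atTop (nhds zz) := by
  rw [tendsto_iff_norm_sub_tendsto_zero]
  have hlim : Filter.Tendsto (fun n : ℕ => (zz - ∑ m ∈ Finset.range n, 1 / ((m : ℝ) + 1) ^ 3)
      + zz / ((n : ℝ) + 1)) Filter.atTop (nhds 0) := by
    have h1 := zz_summable.hasSum.tendsto_sum_nat
    have h2 := (tendsto_const_nhds (x := zz)).sub h1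
    have h3 : Filter.Tendsto (fun n : ℕ => zz / ((n : ℝ) + 1)) Filter.atTop (nhds 0) :=
      Filter.Tendsto.div_atTop tendsto_const_nhds
        (Filter.tendsto_atTop_add_const_right _ _ tendsto_natCast_atTop_atTop)
    have h4 := h2.add h3
    have : zz - ∑' k : ℕ, 1 / ((k : ℝ) + 1) ^ 3 + 0 = 0 := by simp [zz]
    rw [this] at h4
    exact h4
  refine squeeze_zero (fun n => norm_nonneg _) (fun n => ?_) hlim
  rw [Real.norm_eq_abs]
  have hb := bb_pos n
  have e : aa n / bb n - zz = (∑ k ∈ Finset.range (n + 1), lam n k ^ 2 * (cc n k - zz)) / bb n := by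
    simp only [mul_sub, Finset.sum_sub_distrib, ← Finset.sum_mul]
    rw [show ∑ k ∈ Finset.range (n + 1), lam n k ^ 2 = bb n from rfl,
      show ∑ k ∈ Finset.range (n + 1), lam n k ^ 2 * cc n k = aa n from rfl]
    field_simp
  rw [e, abs_div, abs_of_pos hb, div_le_iff₀ hb]
  refine (Finset.abs_sum_le_sum_abs _ _).trans ?_
  rw [mul_comm, bb, Finset.sum_mul]
  apply Finset.sum_le_sum
  intro k hk
  rw [Finset.mem_range] at hk
  rw [abs_mul, abs_of_nonneg (sq_nonneg _)]
  exact mul_le_mul_of_nonneg_left (cc_close n k (by omega)) (sq_nonneg _)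

lemma ratio_step (n : ℕ) : aa (n + 1) / bb (n + 1) - aa n / bb n
    = 6 / (((n : ℝ) + 1) ^ 3 * (bb n * bb (n + 1))) := by
  have h := casoratian n
  have h1 := bb_pos n
  have h2 := bb_pos (n + 1)
  rw [div_sub_div _ _ h2.ne' h1.ne']
  rw [show aa (n + 1) * bb n - bb (n + 1) * aa n = 6 / ((n : ℝ) + 1) ^ 3 by rw [← h]; ring]
  field_simp

lemma ratio_lt (n : ℕ) : aa n / bb n < zz := by
  have hm : StrictMono (fun n => aa n / bb n) := by
    apply strictMono_nat_of_lt_succ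
    intro n
    have h := ratio_step n
    have h1 := bb_pos n
    have h2 := bb_pos (n + 1)
    have : 0 < 6 / (((n : ℝ) + 1) ^ 3 * (bb n * bb (n + 1))) := by positivity
    linarith
  exact lt_of_lt_of_le (hm (Nat.lt_succ_self n)) (hm.monotone.ge_of_tendsto tendsto_ratio (n + 1))

lemma bb_growth' (t : ℕ) : bb 1001 * (329 / 10 : ℝ) ^ t ≤ bb (1001 + t) := by
  induction t with
  | zero => simp
  | succ t ih =>
    have := bb_growth (1000 + t) (by omega)
    rw [show 1000 + t + 1 = 1001 + t by omega, show 1000 + t + 2 = 1001 + (t + 1) by omega] at this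
    rw [pow_succ]
    linarith

lemma bb_tendsto : Filter.Tendsto (fun t => bb (1001 + t)) Filter.atTop Filter.atTop := by
  refine Filter.tendsto_atTop_mono bb_growth' ?_
  exact (tendsto_pow_atTop_atTop_of_one_lt (by norm_num)).const_mul_atTop (bb_pos 1001)

lemma ratio_gt (t : ℕ) : zz ≤ aa (1001 + t) / bb (1001 + t) + 6 / bb (1001 + t) ^ 2 := by
  have hlim : Filter.Tendsto (fun t => aa (1001 + t) / bb (1001 + t) + 6 / bb (1001 + t) ^ 2)
      Filter.atTop (nhds zz) := by
    have h1 : Filter.Tendsto (fun t => aa (1001 + t) / bb (1001 + t)) Filter.atTop (nhds zz) := by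
      have := (Filter.tendsto_add_atTop_iff_nat 1001).2 tendsto_ratio
      simpa only [add_comm] using this
    have h2 : Filter.Tendsto (fun t => 6 / bb (1001 + t) ^ 2) Filter.atTop (nhds 0) :=
      Filter.Tendsto.div_atTop tendsto_const_nhds
        ((Filter.tendsto_pow_atTop (by norm_num)).comp bb_tendsto)
    simpa using h1.add h2
  refine Antitone.le_of_tendsto ?_ hlim t
  apply antitone_nat_of_succ_le
  intro t
  rw [show 1001 + (t + 1) = 1001 + t + 1 by omega]
  have hg := bb_growth (1000 + t) (by omega)
  rw [show 1000 + t + 1 = 1001 + t by omega, show 1000 + t + 2 = 1001 + t + 1 by omega] at hg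
  have hs := ratio_step (1001 + t)
  generalize 1001 + t = n at *
  have h1 := bb_pos n
  have h2 := bb_pos (n + 1)
  have k1 : 6 / (((n : ℝ) + 1) ^ 3 * (bb n * bb (n + 1))) ≤ 6 / (bb n * bb (n + 1)) := by
    apply div_le_div_of_nonneg_left (by norm_num) (by positivity)
    have : (1 : ℝ) ≤ ((n : ℝ) + 1) ^ 3 := one_le_pow₀ (by linarith [Nat.cast_nonneg (α := ℝ) n])
    nlinarith [mul_pos h1 h2]
  have k2 : 6 / (bb n * bb (n + 1)) + 6 / bb (n + 1) ^ 2 ≤ 6 / bb n ^ 2 := by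
    rw [div_add_div _ _ (by positivity) (by positivity), div_le_div_iff₀ (by positivity) (by positivity)]
    have : 2 * bb n ≤ bb (n + 1) := by linarith
    have h3 : 0 ≤ bb n ^ 2 * bb (n + 1) := by positivity
    have h4 : bb n * (bb (n + 1) + bb n) ≤ bb (n + 1) ^ 2 := by nlinarith
    nlinarith [mul_le_mul_of_nonneg_left h4 h3]
  linarith

/-- the integers inside the reals -/
def ZR : Subring ℝ := (Int.castRingHom ℝ).range

lemma nat_mem (n : ℕ) : (n : ℝ) ∈ ZR := ⟨n, by simp⟩

lemma mem_of_ex {x : ℝ} (h : ∃ z : ℤ, x = z) : x ∈ ZR := by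
  obtain ⟨z, rfl⟩ := h
  exact ⟨z, by simp⟩

lemma dvd_lcmUpto (n i : ℕ) (h1 : 1 ≤ i) (h2 : i ≤ n) : i ∣ Nat.lcmUpto n :=
  Finset.dvd_lcm (f := id) (Finset.mem_Icc.2 ⟨h1, h2⟩)

lemma term_int (n k m : ℕ) (hk : k ≤ n) (hm : m < k) :
    (Nat.lcmUpto n : ℝ) ^ 3 * ((n + k).choose k : ℝ) / (((m : ℝ) + 1) ^ 3 * lam n (m + 1)) ∈ ZR := by
  have hD := dvd_lcmUpto n
  have i1 := mem_of_ex (leibniz_int _ n hD m n (by omega) le_rfl)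
  have i2 := mem_of_ex (leibniz_int _ n hD m k (by omega) hk)
  have i3 := mem_of_ex (leibniz_int _ n hD 0 (m + 1) (by omega) (by omega))
  have i4 := nat_mem ((n + k).choose (k - (m + 1)))
  have e : ((n + k).choose k : ℝ) * (k.choose (m + 1) : ℝ)
      = ((n + k).choose (k - (m + 1)) : ℝ) * ((n + (m + 1)).choose (m + 1) : ℝ) := by
    have := Nat.choose_mul (n := n + k) (k := k) (s := k - (m + 1)) (by omega)
    rw [Nat.choose_symm (by omega), show n + k - (k - (m + 1)) = n + (m + 1) by omega,
      show k - (k - (m + 1)) = m + 1 by omega] at this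
    exact_mod_cast this
  have := ZR.mul_mem (ZR.mul_mem i1 i2) (ZR.mul_mem i3 i4)
  convert this using 1
  have p1 : (0 : ℝ) < n.choose (m + 1) := by exact_mod_cast Nat.choose_pos (by omega)
  have p2 : (0 : ℝ) < k.choose (m + 1) := by exact_mod_cast Nat.choose_pos (by omega)
  have p3 : (0 : ℝ) < (n + (m + 1)).choose (m + 1) := by exact_mod_cast Nat.choose_pos (by omega)
  unfold lam
  simp only [zero_add, Nat.choose_one_right]
  push_cast
  field_simp
  linear_combination (Nat.lcmUpto n : ℝ) ^ 3 * e

lemma aa_int (n : ℕ) : 2 * (Nat.lcmUpto n : ℝ) ^ 3 * aa n ∈ ZR := by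
  unfold aa
  rw [Finset.mul_sum]
  apply ZR.sum_mem
  intro k hk
  rw [Finset.mem_range] at hk
  have hl : lam n k ∈ ZR := ZR.mul_mem (nat_mem _) (nat_mem _)
  have e : 2 * (Nat.lcmUpto n : ℝ) ^ 3 * (lam n k ^ 2 * cc n k)
      = 2 * lam n k ^ 2 * (∑ m ∈ Finset.range n, ((Nat.lcmUpto n : ℝ) / ((m : ℝ) + 1)) ^ 3)
      + lam n k * (n.choose k : ℝ) * ∑ m ∈ Finset.range k, (-1) ^ m *
        ((Nat.lcmUpto n : ℝ) ^ 3 * ((n + k).choose k : ℝ) / (((m : ℝ) + 1) ^ 3 * lam n (m + 1))) := by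
    unfold cc
    rw [mul_add, mul_add]
    congr 1
    · simp only [Finset.mul_sum]
      apply Finset.sum_congr rfl
      intro m _
      field_simp
    · simp only [Finset.mul_sum]
      apply Finset.sum_congr rfl
      intro m hm
      rw [Finset.mem_range] at hm
      have : 0 < lam n (m + 1) := lam_pos (by omega)
      rw [show lam n k ^ 2 = lam n k * ((n.choose k : ℝ) * ((n + k).choose k : ℝ)) by
        rw [sq]; rfl]
      field_simp
  rw [e]
  refine ZR.add_mem (ZR.mul_mem (ZR.mul_mem (nat_mem 2) (ZR.pow_mem hl 2)) (ZR.sum_mem ?_))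
    (ZR.mul_mem (ZR.mul_mem hl (nat_mem _)) (ZR.sum_mem ?_))
  · intro m hm
    rw [Finset.mem_range] at hm
    apply ZR.pow_mem
    have := mem_of_ex (leibniz_int _ n (dvd_lcmUpto n) 0 (m + 1) (by omega) (by omega))
    simpa using this
  · intro m hm
    rw [Finset.mem_range] at hm
    exact ZR.mul_mem (ZR.pow_mem (ZR.neg_mem ZR.one_mem) m) (term_int n k m (by omega) hm)

lemma bb_int (n : ℕ) : bb n ∈ ZR :=
  ZR.sum_mem fun _ _ => ZR.pow_mem (ZR.mul_mem (nat_mem _) (nat_mem _)) 2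

lemma one_le_of_mem {x : ℝ} (h : x ∈ ZR) (hx : 0 < x) : 1 ≤ x := by
  obtain ⟨z, rfl⟩ := h
  simp only [eq_intCast] at *
  exact_mod_cast (Int.cast_pos.1 hx : 0 < z)

lemma main : Irrational zz := by
  rintro ⟨q, hq⟩
  obtain ⟨C, hC, hCb⟩ := lcm_bound
  have hden : (0 : ℝ) < q.den := by exact_mod_cast q.den_pos
  have hz : zz * q.den = q.num := by
    rw [← hq]
    exact_mod_cast Rat.mul_den_eq_num q
  obtain ⟨N, G, R⟩ : ∃ N : ℕ, (∀ t : ℕ, bb N * (329 / 10 : ℝ) ^ t ≤ bb (N + t)) ∧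
      (∀ t : ℕ, zz ≤ aa (N + t) / bb (N + t) + 6 / bb (N + t) ^ 2) := ⟨1001, bb_growth', ratio_gt⟩
  have hb0 := bb_pos N
  have key : ∀ t : ℕ, 1 ≤ (12 * q.den * C ^ 3 * ((16 / 5) ^ 3) ^ N / bb N)
      * (32768 / 32900 : ℝ) ^ t := by
    intro t
    have hlo := ratio_lt (N + t)
    have hhi := R t
    have hg := G t
    have hai := aa_int (N + t)
    have hbi := bb_int (N + t)
    have hd := hCb (N + t)
    have hb := bb_pos (N + t)
    have hD : (0 : ℝ) < Nat.lcmUpto (N + t) := by exact_mod_cast Nat.lcmUpto_pos _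
    have hDi := nat_mem (Nat.lcmUpto (N + t))
    set D : ℝ := (Nat.lcmUpto (N + t) : ℝ)
    set b := bb (N + t)
    set a := aa (N + t)
    have hX : 2 * D ^ 3 * (b * q.num) - 2 * D ^ 3 * a * q.den ∈ ZR :=
      ZR.sub_mem (ZR.mul_mem (ZR.mul_mem (nat_mem 2) (ZR.pow_mem hDi 3))
        (ZR.mul_mem hbi (mem_of_ex ⟨q.num, rfl⟩))) (ZR.mul_mem hai (nat_mem _))
    have e : 2 * D ^ 3 * (b * q.num) - 2 * D ^ 3 * a * q.den
        = 2 * D ^ 3 * q.den * (b * zz - a) := by rw [← hz]; ring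
    rw [e] at hX
    rw [div_lt_iff₀ hb] at hlo
    have hup : b * zz - a ≤ 6 / b := by
      have := mul_le_mul_of_nonneg_left hhi hb.le
      have e2 : b * (a / b + 6 / b ^ 2) = a + 6 / b := by field_simp
      linarith
    have h1 := one_le_of_mem hX (mul_pos (by positivity) (by linarith))
    have hD3 : D ^ 3 ≤ (C * (16 / 5) ^ (N + t)) ^ 3 := pow_le_pow_left₀ hD.le hd 3
    calc (1 : ℝ) ≤ 2 * D ^ 3 * q.den * (b * zz - a) := h1
      _ ≤ 2 * D ^ 3 * q.den * (6 / b) := by gcongr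
      _ ≤ 2 * (C * (16 / 5) ^ (N + t)) ^ 3 * q.den * (6 / (bb N * (329 / 10) ^ t)) := by
          gcongr
      _ = _ := by
          rw [show (32768 / 32900 : ℝ) = (16 / 5) ^ 3 / (329 / 10) by norm_num]
          have hy : (329 / 10 : ℝ) ≠ 0 := by norm_num
          generalize (16 / 5 : ℝ) = x
          generalize (329 / 10 : ℝ) = y at hy ⊢
          rw [div_pow (x ^ 3) y t]
          rw [pow_add]
          field_simp
          ring
  have hlim : Filter.Tendsto (fun t : ℕ => (12 * q.den * C ^ 3 * ((16 / 5) ^ 3) ^ N / bb N)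
      * (32768 / 32900 : ℝ) ^ t) Filter.atTop (nhds 0) := by
    have := (tendsto_pow_atTop_nhds_zero_of_lt_one (r := (32768 / 32900 : ℝ)) (by norm_num)
      (by norm_num)).const_mul (12 * q.den * C ^ 3 * ((16 / 5) ^ 3) ^ N / bb N)
    simpa only [mul_zero] using this
  have := ge_of_tendsto' hlim key
  norm_num at this

end Apery

/-- **Apéry's theorem.** The number `ζ(3) = ∑_{k≥1} 1/k³` is irrational. -/
theorem apery_zeta_three_irrational :
    Irrational (∑' k : ℕ, 1 / ((k : ℝ) + 1) ^ 3) := by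
  exact Apery.main
end
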